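/- arXiv:math/0603279 — 2 statements merged into one kernel-verified Lean document; each statement's English description precedes it below -/
import Mathlib

section
/- For every right L-comodule U, the k-linear map (U □_L O) ⊗_A O → U ⊗_k O induced by (Σᵢ uᵢ ⊗ gᵢ) ⊗ h ↦ Σᵢ uᵢ ⊗ gᵢh is well defined and bijective. -/
open TensorProduct

namespace PaperQuotient

variable {k : Type} [Field k]

section Comod

variable (k) (O : Type) [AddCommGroup O] [Module k O] [Coalgebra k O]

/-- The axioms of a right `O`-comodule structure on `V` given by the coaction `ρ`. -/
structure IsComod {V : Type} [AddCommGroup V] [Module k V]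
    (ρ : V →ₗ[k] V ⊗[k] O) : Prop where
  coassoc : ∀ v : V,
    (TensorProduct.assoc k V O O) ((TensorProduct.map ρ (LinearMap.id : O →ₗ[k] O)) (ρ v)) =
      (TensorProduct.map (LinearMap.id : V →ₗ[k] V) (Coalgebra.comul (R := k))) (ρ v)
  counit : ∀ v : V,
    (TensorProduct.rid k V)
      ((TensorProduct.map (LinearMap.id : V →ₗ[k] V) (Coalgebra.counit (R := k))) (ρ v)) = v

/-- `f : V → W` is colinear with respect to the coactions `ρV` and `ρW`. -/
def IsColinear {V W : Type} [AddCommGroup V] [Module k V] [AddCommGroup W] [Module k W]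
    (ρV : V →ₗ[k] V ⊗[k] O) (ρW : W →ₗ[k] W ⊗[k] O) (f : V →ₗ[k] W) : Prop :=
  ∀ v : V, ρW (f v) = (TensorProduct.map f (LinearMap.id : O →ₗ[k] O)) (ρV v)

/-- The map `id ⊗ ε : V ⊗ O → V`. -/
noncomputable def counitMap {V : Type} [AddCommGroup V] [Module k V] :
    V ⊗[k] O →ₗ[k] V :=
  (TensorProduct.rid k V).toLinearMap ∘ₗ
    TensorProduct.map (LinearMap.id : V →ₗ[k] V) (Coalgebra.counit (R := k))

/-- The "free" right coaction `id_V ⊗ Δ` on `V ⊗ O`. -/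
noncomputable def freeCoact {V : Type} [AddCommGroup V] [Module k V] :
    V ⊗[k] O →ₗ[k] (V ⊗[k] O) ⊗[k] O :=
  (TensorProduct.assoc k V O O).symm.toLinearMap ∘ₗ
    LinearMap.lTensor V (Coalgebra.comul (R := k))

end Comod

section CotensorDef

variable (k)
variable {O : Type} [AddCommGroup O] [Module k O] [Coalgebra k O]
variable {L : Type} [AddCommGroup L] [Module k L]

/-- The difference of the two maps `U ⊗ O → U ⊗ (L ⊗ O)` whose equalizer is the
cotensor product `U □_L O`; here `ql : O → L` is the (linear) quotient map. -/
noncomputable def cotensorObstruction (ql : O →ₗ[k] L)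
    {U : Type} [AddCommGroup U] [Module k U] (ρU : U →ₗ[k] U ⊗[k] L) :
    U ⊗[k] O →ₗ[k] U ⊗[k] (L ⊗[k] O) :=
  (TensorProduct.assoc k U L O).toLinearMap ∘ₗ
      (TensorProduct.map ρU (LinearMap.id : O →ₗ[k] O))
    - TensorProduct.map (LinearMap.id : U →ₗ[k] U)
        ((TensorProduct.map ql (LinearMap.id : O →ₗ[k] O)) ∘ₗ Coalgebra.comul (R := k))

/-- The cotensor product `U □_L O` as a subspace of `U ⊗ O`. -/
noncomputable def cotensor (ql : O →ₗ[k] L)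
    {U : Type} [AddCommGroup U] [Module k U] (ρU : U →ₗ[k] U ⊗[k] L) :
    Submodule k (U ⊗[k] O) :=
  LinearMap.ker (cotensorObstruction k ql ρU)

end CotensorDef

section HopfSetup

variable (k)
variable (O : Type) [CommRing O] [HopfAlgebra k O]

/-- `A` is a Hopf subalgebra of `O`: it is closed under comultiplication and antipode. -/
structure IsHopfSub (A : Subalgebra k O) : Prop where
  comul_mem : ∀ a ∈ A, Coalgebra.comul (R := k) a ∈
    Submodule.span k {x : O ⊗[k] O | ∃ b ∈ A, ∃ c ∈ A, x = b ⊗ₜ[k] c}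
  antipode_mem : ∀ a ∈ A, HopfAlgebra.antipode (R := k) a ∈ A

/-- The set of elements of the augmentation ideal `A⁺ = A ∩ ker ε` of `A`. -/
def augSet (A : Subalgebra k O) : Set O :=
  {a : O | a ∈ A ∧ Coalgebra.counit (R := k) a = 0}

variable (L : Type) [CommRing L] [HopfAlgebra k L]

/-- `q : O → L` realizes `L` as the quotient Hopf algebra `O ⊗_A k = O/(A⁺O)`. -/
structure IsQuotientHopf (A : Subalgebra k O) (q : O →ₐc[k] L) : Prop where
  surj : Function.Surjective q
  ker : RingHom.ker (q : O →ₐ[k] L) = Ideal.span (augSet k O A)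

/-- The coaction of `L` on an `O`-comodule obtained by restriction along `q`. -/
noncomputable def resCoact (q : O →ₐc[k] L) {V : Type} [AddCommGroup V] [Module k V]
    (ρV : V →ₗ[k] V ⊗[k] O) : V →ₗ[k] V ⊗[k] L :=
  (LinearMap.lTensor V (q : O →ₗ[k] L)) ∘ₗ ρV

/-- The multiplication map `(U ⊗ O) ⊗ O → U ⊗ O`, `(u ⊗ g) ⊗ h ↦ u ⊗ gh`. -/
noncomputable def multMap (U : Type) [AddCommGroup U] [Module k U] :
    (U ⊗[k] O) ⊗[k] O →ₗ[k] U ⊗[k] O :=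
  (LinearMap.lTensor U (LinearMap.mul' k O)) ∘ₗ (TensorProduct.assoc k U O O).toLinearMap

/-- The diagonal coaction on the tensor product of two comodules. -/
noncomputable def tensorCoact {X Y : Type} [AddCommGroup X] [Module k X]
    [AddCommGroup Y] [Module k Y]
    (ρX : X →ₗ[k] X ⊗[k] O) (ρY : Y →ₗ[k] Y ⊗[k] O) :
    X ⊗[k] Y →ₗ[k] (X ⊗[k] Y) ⊗[k] O :=
  (TensorProduct.map (LinearMap.id : X ⊗[k] Y →ₗ[k] X ⊗[k] Y) (LinearMap.mul' k O)) ∘ₗ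
    (TensorProduct.tensorTensorTensorComm k X O Y O).toLinearMap ∘ₗ
      (TensorProduct.map ρX ρY)

/-- The diagonal coaction on `X ⊗ O`, `x ⊗ a ↦ Σ (x₀ ⊗ a₁) ⊗ x₁a₂`. -/
noncomputable def diagCoact {X : Type} [AddCommGroup X] [Module k X]
    (ρX : X →ₗ[k] X ⊗[k] O) :
    X ⊗[k] O →ₗ[k] (X ⊗[k] O) ⊗[k] O :=
  tensorCoact k O ρX (Coalgebra.comul (R := k))

end HopfSetup

end PaperQuotient

namespace PaperQuotient

/-- A bundled right `O`-comodule. -/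
structure Comod (k O : Type) [Field k] [AddCommGroup O] [Module k O] [Coalgebra k O] where
  carrier : Type
  [acg : AddCommGroup carrier]
  [mod : Module k carrier]
  ρ : carrier →ₗ[k] carrier ⊗[k] O
  comod : IsComod k O ρ

attribute [instance] Comod.acg Comod.mod

end PaperQuotient

namespace PaperQuotient

open Coalgebra HopfAlgebra

section Flatness

variable {k : Type} [Field k] {O : Type} [CommRing O] [HopfAlgebra k O]

/-- The algebra map `O ⊗ O → O ⊗ O`, `u ⊗ h ↦ Δ(u)(1 ⊗ ι(h))`. -/
noncomputable def comulAntipode : O ⊗[k] O →ₐ[k] O ⊗[k] O :=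
  Algebra.TensorProduct.productMap (Bialgebra.comulAlgHom k O)
    (Algebra.TensorProduct.includeRight.comp (antipodeAlgHom k O))

lemma comulAntipode_tmul (u h : O) :
    comulAntipode (u ⊗ₜ[k] h) = comul (R := k) u * (1 ⊗ₜ antipode k h) := rfl

lemma comulAntipode_comul (x : O) : comulAntipode (comul (R := k) x) = x ⊗ₜ[k] 1 := by
  have h1 : ∀ t : O ⊗[k] O, comulAntipode t =
      (LinearMap.mul' k O ∘ₗ (antipode k).lTensor O).lTensor O
        (TensorProduct.assoc k O O O (comul.rTensor O t)) := by
    intro t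
    induction t with
    | zero => simp
    | add a b ha hb => simp only [map_add, ha, hb]
    | tmul u h =>
      rw [comulAntipode_tmul, LinearMap.rTensor_tmul]
      generalize comul (R := k) u = w
      induction w with
      | zero => simp
      | add a b ha hb => simp only [map_add, add_mul, TensorProduct.add_tmul, ha, hb]
      | tmul a b => simp
  rw [h1, coassoc_apply, ← LinearMap.comp_apply, ← LinearMap.lTensor_comp]
  have h2 : (LinearMap.mul' k O ∘ₗ (antipode k).lTensor O) ∘ₗ comul =
      Algebra.linearMap k O ∘ₗ counit := by
    ext y; simp
  rw [h2, LinearMap.lTensor_comp, LinearMap.comp_apply, lTensor_counit_comul]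
  simp

/-- Contraction `u ⊗ h ↦ f(h) u` of the second tensor factor. -/
noncomputable def slice {V : Type} [AddCommGroup V] [Module k V] (f : O →ₗ[k] k) :
    V ⊗[k] O →ₗ[k] V :=
  (TensorProduct.rid k V).toLinearMap ∘ₗ f.lTensor V

@[simp]
lemma slice_tmul {V : Type} [AddCommGroup V] [Module k V] (f : O →ₗ[k] k) (u : V) (h : O) :
    slice f (u ⊗ₜ[k] h) = f h • u := by
  simp [slice]

lemma slice_tmul_mul (f : O →ₗ[k] k) (u h : O) (t : O ⊗[k] O) :
    slice f ((u ⊗ₜ[k] h) * t) = u * slice (f ∘ₗ LinearMap.mulLeft k h) t := by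
  induction t with
  | zero => simp
  | add a b ha hb => simp only [mul_add, map_add, ha, hb]
  | tmul a b => simp

variable {A : Subalgebra k O}

/-- A Hopf subalgebra comultiplies into the image of its tensor square. -/
lemma IsHopfSub.exists_comul_eq (hA : IsHopfSub k O A) (a : O) (ha : a ∈ A) :
    ∃ t : A ⊗[k] A, TensorProduct.map A.val.toLinearMap A.val.toLinearMap t =
      comul (R := k) a := by
  have h := hA.comul_mem a ha
  rw [← LinearMap.mem_range]
  refine (Submodule.span_le.2 ?_) h
  rintro _ ⟨b, hb, c, hc, rfl⟩
  exact ⟨⟨b, hb⟩ ⊗ₜ ⟨c, hc⟩, by simp⟩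

variable {M : Submodule A O}

/-- The compatibility of a coaction on an `A`-submodule `M` of `O` with the comultiplication. -/
def IsSubCoact (M : Submodule A O) (ρ : M →ₗ[k] M ⊗[k] O) : Prop :=
  ∀ m, (M.subtype.restrictScalars k).rTensor O (ρ m) = comul (R := k) (m : O)

/-- The diagonal action of `A ⊗ O` on `M ⊗ O`. -/
noncomputable def diagAct (M : Submodule A O) :
    A ⊗[k] A →ₗ[k] (M ⊗[k] O →ₗ[k] M ⊗[k] O) :=
  TensorProduct.homTensorHomMap (RingHom.id k) M O M O ∘ₗ
    TensorProduct.map (Algebra.lsmul k k M).toLinearMap (LinearMap.mul k O ∘ₗ A.val.toLinearMap)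

@[simp]
lemma diagAct_tmul (a b : A) (m : M) (h : O) :
    diagAct M (a ⊗ₜ[k] b) (m ⊗ₜ[k] h) = (a • m) ⊗ₜ[k] ((b : O) * h) := by
  simp [diagAct]

lemma rTensor_diagAct (θ : M →ₗ[A] O) (t : A ⊗[k] A) (z : M ⊗[k] O) :
    (θ.restrictScalars k).rTensor O (diagAct M t z) =
      TensorProduct.map A.val.toLinearMap A.val.toLinearMap t *
        (θ.restrictScalars k).rTensor O z := by
  induction z with
  | zero => simp
  | add a b ha hb => simp only [mul_add, map_add, ha, hb]
  | tmul m h =>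
    induction t with
    | zero => rw [LinearMap.map_zero, LinearMap.zero_apply, map_zero, map_zero, zero_mul]
    | add a b ha hb =>
      rw [LinearMap.map_add, LinearMap.add_apply, map_add, ha, hb, map_add, add_mul]
    | tmul a b => simp [Algebra.smul_def]

lemma subtype_rTensor_injective (M : Submodule A O) :
    Function.Injective ((M.subtype.restrictScalars k).rTensor O) :=
  Module.Flat.rTensor_preserves_injective_linearMap _ M.injective_subtype

lemma IsSubCoact.smul {ρ : M →ₗ[k] M ⊗[k] O} (hρ : IsSubCoact M ρ) (a : A) (t : A ⊗[k] A)
    (ht : TensorProduct.map A.val.toLinearMap A.val.toLinearMap t = comul (R := k) (a : O))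
    (m : M) : ρ (a • m) = diagAct M t (ρ m) := by
  apply subtype_rTensor_injective M
  rw [rTensor_diagAct, hρ, hρ, ht, ← Bialgebra.comul_mul]
  rfl

/-- The map `m ↦ Δ(θ(m₀))(1 ⊗ ι(m₁))`. -/
noncomputable def twist (ρ : M →ₗ[k] M ⊗[k] O) (θ : M →ₗ[A] O) : M →ₗ[k] O ⊗[k] O :=
  comulAntipode.toLinearMap ∘ₗ (θ.restrictScalars k).rTensor O ∘ₗ ρ

lemma twist_smul (hA : IsHopfSub k O A) {ρ : M →ₗ[k] M ⊗[k] O} (hρ : IsSubCoact M ρ)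
    (θ : M →ₗ[A] O) (a : A) (m : M) :
    twist ρ θ (a • m) = ((a : O) ⊗ₜ[k] 1) * twist ρ θ m := by
  obtain ⟨t, ht⟩ := hA.exists_comul_eq a a.2
  simp only [twist, LinearMap.comp_apply, AlgHom.toLinearMap_apply]
  rw [hρ.smul a t ht, rTensor_diagAct, ht, map_mul, comulAntipode_comul]

/-- The `A`-linear map `m ↦ (id ⊗ f)(Δ(θ(m₀))(1 ⊗ ι(m₁)))`. -/
noncomputable def translate (hA : IsHopfSub k O A) {ρ : M →ₗ[k] M ⊗[k] O}
    (hρ : IsSubCoact M ρ) (f : O →ₗ[k] k) (θ : M →ₗ[A] O) : M →ₗ[A] O where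
  toFun m := slice f (twist ρ θ m)
  map_add' := by simp
  map_smul' a m := by
    rw [twist_smul hA hρ, slice_tmul_mul]
    have : f ∘ₗ LinearMap.mulLeft k (1 : O) = f := by ext; simp
    rw [this]
    rfl

/-- The `O`-span of the `A`-linear maps `M → A` inside the `A`-linear maps `M → O`. -/
def factorSpan (M : Submodule A O) : Submodule A (M →ₗ[A] O) :=
  Submodule.span A {θ | ∃ φ : M →ₗ[A] O, (∀ m, φ m ∈ A) ∧ ∃ o : O, θ = o • φ}

lemma translate_mem_of_range_le (hA : IsHopfSub k O A) {ρ : M →ₗ[k] M ⊗[k] O}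
    (hρ : IsSubCoact M ρ) (f : O →ₗ[k] k) (φ : M →ₗ[A] O) (hφ : ∀ m, φ m ∈ A) (m : M) :
    translate hA hρ f φ m ∈ A := by
  change slice f (comulAntipode ((φ.restrictScalars k).rTensor O (ρ m))) ∈ A
  generalize ρ m = z
  induction z with
  | zero => simp
  | add a b ha hb => simp only [map_add]; exact add_mem ha hb
  | tmul m h =>
    obtain ⟨t, ht⟩ := hA.exists_comul_eq _ (hφ m)
    rw [LinearMap.rTensor_tmul, comulAntipode_tmul, LinearMap.restrictScalars_apply, ← ht]
    clear ht
    induction t with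
    | zero => simp
    | add a b ha hb => simp only [map_add, add_mul]; exact add_mem ha hb
    | tmul a b => simpa using A.smul_mem a.2 _

lemma translate_mem_factorSpan (hA : IsHopfSub k O A) {ρ : M →ₗ[k] M ⊗[k] O}
    (hρ : IsSubCoact M ρ) (θ : M →ₗ[A] O) (hθ : θ ∈ factorSpan M) (f : O →ₗ[k] k) :
    translate hA hρ f θ ∈ factorSpan M := by
  induction hθ using Submodule.closure_induction generalizing f with
  | zero =>
    convert (factorSpan M).zero_mem
    ext m
    simp [translate, twist]
  | add θ₁ θ₂ _ _ h₁ h₂ =>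
    convert add_mem (h₁ f) (h₂ f)
    ext m
    simp [translate, twist, LinearMap.rTensor_add, LinearMap.restrictScalars_add]
  | smul_mem a θ hθ =>
    obtain ⟨φ, hφ, o, rfl⟩ := hθ
    have key : ∀ w : O ⊗[k] O, ∃ θ' ∈ factorSpan M,
        ∀ m, θ' m = slice f (w * twist ρ φ m) := by
      intro w
      induction w with
      | zero => exact ⟨0, zero_mem _, by simp⟩
      | add w₁ w₂ h₁ h₂ =>
        obtain ⟨θ₁, h₁, e₁⟩ := h₁
        obtain ⟨θ₂, h₂, e₂⟩ := h₂
        exact ⟨θ₁ + θ₂, add_mem h₁ h₂, by simp [e₁, e₂, add_mul]⟩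
      | tmul u h =>
        refine ⟨u • translate hA hρ (f ∘ₗ LinearMap.mulLeft k h) φ, Submodule.subset_span
          ⟨_, translate_mem_of_range_le hA hρ _ φ hφ, u, rfl⟩, fun m ↦ ?_⟩
        rw [slice_tmul_mul]
        rfl
    obtain ⟨θ', h', e⟩ := key (comul (R := k) ((a : O) * o))
    convert h'
    ext m
    rw [e]
    change slice f (comulAntipode (((a • o • φ).restrictScalars k).rTensor O (ρ m))) =
      slice f (_ * comulAntipode ((φ.restrictScalars k).rTensor O (ρ m)))
    congr 1
    generalize ρ m = z
    induction z with
    | zero => simp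
    | add x y hx hy => simp only [map_add, mul_add, hx, hy]
    | tmul m h =>
      simp [comulAntipode_tmul, Algebra.smul_def, Bialgebra.comul_mul, mul_assoc]

/-- The ideal of elements of `A` which act on `M ⊆ O` through finite free `A`-modules. -/
def factorIdeal (M : Submodule A O) : Ideal A :=
  (factorSpan M).comap (LinearMap.toSpanSingleton A _ M.subtype)

lemma mem_factorIdeal {a : A} : a ∈ factorIdeal M ↔ a • M.subtype ∈ factorSpan M := Iff.rfl

lemma slice_mem_factorIdeal (hA : IsHopfSub k O A) {ρ : M →ₗ[k] M ⊗[k] O}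
    (hρ : IsSubCoact M ρ) {a : A} (ha : a ∈ factorIdeal M) (t : A ⊗[k] A)
    (ht : TensorProduct.map A.val.toLinearMap A.val.toLinearMap t = comul (R := k) (a : O))
    (f : A →ₗ[k] k) :
    TensorProduct.rid k A (f.lTensor A t) ∈ factorIdeal M := by
  obtain ⟨g, rfl⟩ := f.exists_extend (p := Subalgebra.toSubmodule A)
  rw [mem_factorIdeal] at ha ⊢
  convert translate_mem_factorSpan hA hρ _ ha g
  ext m
  change _ = slice g (comulAntipode (((a • M.subtype).restrictScalars k).rTensor O (ρ m)))
  have h1 : ((a • M.subtype).restrictScalars k).rTensor O (ρ m) =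
      ((a : O) ⊗ₜ 1) * comul (R := k) (m : O) := by
    rw [← hρ]
    generalize ρ m = z
    induction z with
    | zero => simp
    | add x y hx hy => simp only [map_add, mul_add, hx, hy]
    | tmul m h => simp [Algebra.smul_def]
  rw [h1, map_mul, comulAntipode_comul, comulAntipode_tmul, antipode_one, ← ht]
  clear ht h1 ha
  induction t with
  | zero => simp
  | add x y hx hy =>
    simp only [map_add, add_mul, ← hx, ← hy]
    simp [add_smul]
  | tmul x y =>
    simp only [LinearMap.lTensor_tmul, TensorProduct.rid_tmul, TensorProduct.map_tmul,
      Algebra.TensorProduct.tmul_mul_tmul, mul_one, slice_tmul, smul_assoc]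
    rfl

/-- The ideal `factorIdeal M` is stable under the coaction, hence contains the scalars `ε(a)`
for all its elements `a`. -/
lemma factorIdeal_eq_top (hA : IsHopfSub k O A) {ρ : M →ₗ[k] M ⊗[k] O}
    (hρ : IsSubCoact M ρ) {a : A} (ha : a ∈ factorIdeal M)
    (hε : counit (R := k) (a : O) ≠ 0) : factorIdeal M = ⊤ := by
  obtain ⟨t, ht⟩ := hA.exists_comul_eq a a.2
  have key : algebraMap k A (counit (R := k) (a : O)) ∈ factorIdeal M := by
    let b := Module.Free.chooseBasis k A
    let c := TensorProduct.equivFinsuppOfBasisRight (M := A) b t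
    have hc : ∀ i, c i ∈ factorIdeal M := fun i ↦ by
      simp only [c, TensorProduct.equivFinsuppOfBasisRight_apply]
      exact slice_mem_factorIdeal hA hρ ha t ht _
    have htc : t = c.sum fun i m ↦ m ⊗ₜ[k] b i := by
      rw [← TensorProduct.equivFinsuppOfBasisRight_symm_apply, LinearEquiv.symm_apply_apply]
    have h2 : algebraMap k A (counit (R := k) (a : O)) =
        c.sum fun i m ↦ m * ⟨antipode k (b i : O), hA.antipode_mem _ (b i).2⟩ := by
      apply Subtype.ext
      rw [Subalgebra.coe_algebraMap, ← mul_antipode_lTensor_comul_apply, ← ht, htc]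
      simp [Finsupp.sum]
    rw [h2]
    exact Submodule.sum_mem _ fun i _ ↦ Ideal.mul_mem_right _ _ (hc i)
  exact Ideal.eq_top_of_isUnit_mem _ key ((Ne.isUnit hε).map _)

/-- Local generators of a finite module at the augmentation ideal, with dual functionals. -/
lemma exists_local_generators (N : Type) [AddCommGroup N] [Module k N] [Module A N]
    [IsScalarTower k A N] [Module.Finite A N] :
    ∃ (r : ℕ) (l : Fin r → (N →ₗ[k] k)) (n : Fin r → N) (s : A),
      (∀ j (a : A) x, l j (a • x) = counit (R := k) (a : O) * l j x) ∧
      (∀ i j, l j (n i) = if i = j then 1 else 0) ∧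
      counit (R := k) (s : O) = 1 ∧ ∀ x, s • x ∈ Submodule.span A (Set.range n) := by
  let e : A →ₐ[k] k := (Bialgebra.counitAlgHom k O).comp A.val
  have he : ∀ a, e a = counit (R := k) (a : O) := fun _ ↦ rfl
  let I : Ideal A := RingHom.ker e
  let P : Submodule A N := I • ⊤
  have hsmul : ∀ (a : A) (x : N ⧸ P), a • x = e a • x := by
    intro a x
    obtain ⟨y, rfl⟩ := P.mkQ_surjective x
    rw [← sub_eq_zero, ← algebraMap_smul A (e a), ← sub_smul, ← map_smul]
    refine (Submodule.Quotient.mk_eq_zero _).2 (Submodule.smul_mem_smul ?_ trivial)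
    simp [I, RingHom.mem_ker]
  have : Module.Finite k (N ⧸ P) := by
    obtain ⟨S, hS⟩ := (inferInstance : Module.Finite A (N ⧸ P))
    refine ⟨S, eq_top_iff.2 fun x _ ↦ ?_⟩
    have hx : x ∈ Submodule.span A (S : Set (N ⧸ P)) := hS ▸ trivial
    induction hx using Submodule.span_induction with
    | mem x h => exact Submodule.subset_span h
    | zero => exact zero_mem _
    | add x y _ _ hx hy => exact add_mem (hx trivial) (hy trivial)
    | smul a x _ hx => rw [hsmul]; exact Submodule.smul_mem _ _ (hx trivial)
  let b := Module.finBasis k (N ⧸ P)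
  choose n hn using fun i ↦ P.mkQ_surjective (b i)
  have htop : (⊤ : Submodule A N) ≤ Submodule.span A (Set.range n) ⊔ I • ⊤ := by
    intro x _
    have hx := b.sum_repr (P.mkQ x)
    rw [← sub_add_cancel x (∑ i, algebraMap k A (b.repr (P.mkQ x) i) • n i), add_comm]
    refine Submodule.add_mem_sup (Submodule.sum_mem _ fun i _ ↦ Submodule.smul_mem _ _
      (Submodule.subset_span ⟨i, rfl⟩)) ?_
    change _ ∈ P
    rw [← Submodule.Quotient.mk_eq_zero, ← Submodule.mkQ_apply, map_sub, map_sum, sub_eq_zero]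
    simp_rw [map_smul, hn, algebraMap_smul]
    exact hx.symm
  obtain ⟨s, hs, hs'⟩ := Submodule.exists_sub_one_mem_and_smul_le_of_fg_of_le_sup
    Module.Finite.fg_top le_rfl htop
  refine ⟨_, fun j ↦ b.coord j ∘ₗ P.mkQ.restrictScalars k, n, s, fun j a x ↦ ?_,
    fun i j ↦ ?_, ?_, fun x ↦ hs' (Submodule.smul_mem_pointwise_smul _ _ _ trivial)⟩
  · simp only [LinearMap.comp_apply, LinearMap.restrictScalars_apply, map_smul, hsmul]
    rfl
  · simp only [LinearMap.comp_apply, LinearMap.restrictScalars_apply, hn]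
    simp [Finsupp.single_apply]
  · have := (RingHom.mem_ker).1 hs
    rw [map_sub, map_one, sub_eq_zero] at this
    exact this

/-- The matrix coefficient `m ↦ Σ l(m₀) m₁`. -/
noncomputable def matrixCoeff (ρ : M →ₗ[k] M ⊗[k] O) (l : M →ₗ[k] k) : M →ₗ[k] O :=
  (TensorProduct.lid k O).toLinearMap ∘ₗ l.rTensor O ∘ₗ ρ

lemma matrixCoeff_smul (hA : IsHopfSub k O A) {ρ : M →ₗ[k] M ⊗[k] O} (hρ : IsSubCoact M ρ)
    (l : M →ₗ[k] k) (hl : ∀ (a : A) x, l (a • x) = counit (R := k) (a : O) * l x)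
    (a : A) (m : M) : matrixCoeff ρ l (a • m) = a * matrixCoeff ρ l m := by
  obtain ⟨t, ht⟩ := hA.exists_comul_eq a a.2
  simp only [matrixCoeff, LinearMap.comp_apply, LinearEquiv.coe_coe, hρ.smul a t ht]
  have h1 := rTensor_counit_comul (R := k) (a : O)
  rw [← ht] at h1
  have h2 : (a : O) = TensorProduct.lid k O (counit.rTensor O
      (TensorProduct.map A.val.toLinearMap A.val.toLinearMap t)) := by
    rw [h1]; simp
  rw [h2]
  clear h1 h2 ht
  generalize ρ m = z
  induction t with
  | zero => simp
  | add x y hx hy => rw [map_add, LinearMap.add_apply, map_add, map_add, hx, hy, map_add, map_add,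
      map_add, add_mul]
  | tmul x y =>
    induction z with
    | zero => simp
    | add z w hz hw => simp only [map_add, mul_add, hz, hw]
    | tmul m h =>
      simp only [diagAct_tmul, LinearMap.rTensor_tmul, hl, TensorProduct.lid_tmul,
        TensorProduct.map_tmul]
      simp [Algebra.smul_def]; ring

/-- The coaction on `M` is coassociative and counital, in the form `Σ m₀ ⊗ m₁ι(m₂) = m ⊗ 1`. -/
lemma IsSubCoact.antipode {ρ : M →ₗ[k] M ⊗[k] O} (hρ : IsSubCoact M ρ) (m : M) :
    (LinearMap.mul' k O ∘ₗ (antipode k).lTensor O).lTensor M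
      (TensorProduct.assoc k M O O (ρ.rTensor O (ρ m))) = m ⊗ₜ 1 := by
  apply subtype_rTensor_injective M
  rw [LinearMap.rTensor_tmul, LinearMap.restrictScalars_apply, Submodule.subtype_apply,
    ← comulAntipode_comul, ← hρ m]
  generalize ρ m = z
  induction z with
  | zero => simp
  | add z w hz hw => simp only [map_add, hz, hw]
  | tmul m h =>
    rw [LinearMap.rTensor_tmul, LinearMap.rTensor_tmul, comulAntipode_tmul,
      LinearMap.restrictScalars_apply, Submodule.subtype_apply, ← hρ m]
    generalize ρ m = z
    induction z with
    | zero => simp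
    | add z w hz hw => simp only [map_add, TensorProduct.add_tmul, add_mul, hz, hw]
    | tmul n g => simp

lemma matrixCoeff_antipode {ρ : M →ₗ[k] M ⊗[k] O} (hρ : IsSubCoact M ρ)
    (l : M →ₗ[k] k) (m : M) :
    LinearMap.mul' k O (TensorProduct.map (matrixCoeff ρ l) (antipode k) (ρ m)) =
      algebraMap k O (l m) := by
  have h := congrArg (fun z ↦ TensorProduct.lid k O (l.rTensor O z)) (hρ.antipode m)
  simp only [LinearMap.rTensor_tmul, TensorProduct.lid_tmul, ← Algebra.algebraMap_eq_smul_one] at h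
  rw [← h]
  generalize ρ m = z
  induction z with
  | zero => simp
  | add z w hz hw => simp only [map_add, hz, hw]
  | tmul m h =>
    simp only [TensorProduct.map_tmul, LinearMap.mul'_apply, matrixCoeff, LinearMap.comp_apply,
      LinearEquiv.coe_coe, LinearMap.rTensor_tmul]
    generalize ρ m = z
    induction z with
    | zero => simp
    | add z w hz hw => simp only [map_add, TensorProduct.add_tmul, add_mul, hz, hw]
    | tmul n g => simp

lemma exists_mem_factorIdeal (hA : IsHopfSub k O A) {ρ : M →ₗ[k] M ⊗[k] O}
    (hρ : IsSubCoact M ρ) [Module.Finite A M] :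
    ∃ a ∈ factorIdeal M, counit (R := k) (a : O) ≠ 0 := by
  obtain ⟨r, l, n, s, hl, hln, hεs, hs⟩ := exists_local_generators (O := O) (A := A) M
  let G : M → Fin r → O := fun m j ↦ matrixCoeff ρ (l j) m
  have G_smul : ∀ (a : A) m, G (a • m) = (a : O) • G m := fun a m ↦ by
    ext j; simp [G, matrixCoeff_smul hA hρ (l j) (hl j)]
  have G_add : ∀ m m', G (m + m') = G m + G m' := fun m m' ↦ by
    ext j; simp [G]
  let P : Submodule O (Fin r → O) := Submodule.span O (Set.range fun i ↦ G (n i))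
  have hP : ∀ m, (s : O) • G m ∈ P := by
    intro m
    rw [← G_smul]
    have h := hs m
    generalize s • m = x at h
    induction h using Submodule.span_induction with
    | mem x h => obtain ⟨i, rfl⟩ := h; exact Submodule.subset_span ⟨i, rfl⟩
    | zero => convert P.zero_mem; ext j; simp [G]
    | add x y _ _ hx hy => rw [G_add]; exact add_mem hx hy
    | smul a x _ hx => rw [G_smul]; exact P.smul_mem _ hx
  have hP' : ∀ z : M ⊗[k] O, (fun j ↦ (s : O) * LinearMap.mul' k O
      (TensorProduct.map (matrixCoeff ρ (l j)) (antipode k) z)) ∈ P := by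
    intro z
    induction z with
    | zero => simp only [map_zero, mul_zero]; exact P.zero_mem
    | add z w hz hw => simp only [map_add, mul_add]; exact add_mem hz hw
    | tmul m h =>
      convert P.smul_mem (antipode k h) (hP m)
      simp [G]
      ring
  have hP'' : ∀ i, ∃ c : Fin r → O, ∑ i', c i' • G (n i') =
      fun j ↦ if i = j then (s : O) else 0 := by
    intro i
    rw [← Submodule.mem_span_range_iff_exists_fun]
    convert hP' (ρ (n i)) with j
    rw [matrixCoeff_antipode hρ, hln]
    split_ifs <;> simp
  choose c hc using hP''
  let g : Matrix (Fin r) (Fin r) O := .of fun i ↦ G (n i)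
  have hcg : Matrix.of c * g = Matrix.diagonal fun _ ↦ (s : O) := by
    ext i j
    have := congrFun (hc i) j
    simpa [Matrix.mul_apply, g, Matrix.diagonal_apply] using this
  have hdet : (Matrix.of c).det * g.det = (s : O) ^ r := by
    rw [← Matrix.det_mul, hcg]; simp
  have hker : ∀ a : Fin r → A, ∑ i, a i • n i = 0 → s ^ r • a = 0 := by
    intro a ha
    have h1 : Matrix.vecMul (fun i ↦ (a i : O)) g = 0 := by
      have h2 : G (∑ i, a i • n i) = ∑ i, (a i : O) • G (n i) := by
        simp_rw [← G_smul]
        ext j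
        simp [G]
      ext j
      rw [ha] at h2
      have := congrFun h2 j
      simpa [G, g, Matrix.vecMul, dotProduct] using this.symm
    have h3 : g.det • (fun i ↦ (a i : O)) = 0 := by
      rw [← Matrix.vecMul_one (g.det • fun i ↦ (a i : O)), Matrix.smul_vecMul,
        ← Matrix.vecMul_smul, ← Matrix.mul_adjugate, ← Matrix.vecMul_vecMul, h1,
        Matrix.zero_vecMul]
    ext i
    have := congrFun h3 i
    simp only [Pi.smul_apply, smul_eq_mul, Pi.zero_apply] at this
    simp [← hdet, mul_assoc, this]
  choose d hd using fun m ↦ (Submodule.mem_span_range_iff_exists_fun A).1 (hs m)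
  let φ : M →ₗ[A] (Fin r → A) :=
    { toFun := fun m ↦ s ^ r • d m
      map_add' := fun x y ↦ by
        rw [← smul_add, ← sub_eq_zero, ← smul_sub]
        apply hker
        rw [← Fintype.linearCombination_apply, map_sub, map_add]
        simp only [Fintype.linearCombination_apply, hd, smul_add, sub_self]
      map_smul' := fun a x ↦ by
        rw [RingHom.id_apply, smul_comm a, ← sub_eq_zero, ← smul_sub]
        apply hker
        rw [← Fintype.linearCombination_apply, map_sub, map_smul]
        simp only [Fintype.linearCombination_apply, hd, smul_comm s a, sub_self] }
  refine ⟨s ^ r * s, ?_, ?_⟩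
  · rw [mem_factorIdeal]
    have : (s ^ r * s) • M.subtype = ∑ i, ((n i : M) : O) •
        (Algebra.linearMap A O ∘ₗ LinearMap.proj i ∘ₗ φ) := by
      ext m
      have := congrArg (fun x : M ↦ s ^ r • (x : O)) (hd m)
      simp only [mul_smul, LinearMap.smul_apply, Submodule.subtype_apply]
      rw [← Submodule.coe_smul s m, ← this]
      simp only [φ, AddSubmonoidClass.coe_finsetSum, Finset.smul_sum, LinearMap.sum_apply]
      refine Finset.sum_congr rfl fun i _ ↦ ?_
      simp [Algebra.smul_def]
      ring
    rw [this]
    exact sum_mem fun i _ ↦ Submodule.subset_span ⟨_, fun m ↦ (φ m i).2, _, rfl⟩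
  · simp [Bialgebra.counit_mul, Bialgebra.counit_pow, hεs]

/-- Local finiteness: finitely many elements lie in a finitely generated stable submodule. -/
lemma exists_finite_subCoact (hA : IsHopfSub k O A) {r : ℕ} (x : Fin r → O) :
    ∃ M : Submodule A O, Module.Finite A M ∧ (∃ ρ : M →ₗ[k] M ⊗[k] O, IsSubCoact M ρ) ∧
      ∀ i, x i ∈ M := by
  let b := Module.Free.chooseBasis k O
  let u : Fin r → _ →₀ O := fun i ↦
    TensorProduct.equivFinsuppOfBasisRight b (comul (R := k) (x i))
  have hu : ∀ i, comul (R := k) (x i) = (u i).sum fun j m ↦ m ⊗ₜ[k] b j := fun i ↦ by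
    rw [← TensorProduct.equivFinsuppOfBasisRight_symm_apply, LinearEquiv.symm_apply_apply]
  have hu' : ∀ i j, u i j = slice (b.coord j) (comul (R := k) (x i)) := fun i j ↦
    TensorProduct.equivFinsuppOfBasisRight_apply ..
  let S : Set O := ⋃ i, (fun j ↦ u i j) '' (u i).support
  have hS : S.Finite := Set.finite_iUnion fun i ↦ (u i).support.finite_toSet.image _
  let M : Submodule A O := Submodule.span A S
  have huM : ∀ i, ∀ j ∈ (u i).support, u i j ∈ M := fun i j hj ↦
    Submodule.subset_span (Set.mem_iUnion.2 ⟨i, j, hj, rfl⟩)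
  let R := LinearMap.range ((M.subtype.restrictScalars k).rTensor O)
  have hR : ∀ m ∈ M, comul (R := k) m ∈ R := by
    intro m hm
    induction hm using Submodule.span_induction with
    | zero => simp
    | add y z _ _ hy hz => rw [map_add]; exact add_mem hy hz
    | smul a y _ hy =>
      obtain ⟨z, hz⟩ := hy
      obtain ⟨t, ht⟩ := hA.exists_comul_eq a a.2
      refine ⟨diagAct M t z, ?_⟩
      rw [rTensor_diagAct, ht, hz, ← Bialgebra.comul_mul]
      rfl
    | mem y hy =>
      obtain ⟨i, hy⟩ := Set.mem_iUnion.1 hy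
      obtain ⟨j, -, rfl⟩ := hy
      have h1 : ∀ t : O ⊗[k] O, comul (R := k) (slice (b.coord j) t) =
          slice (b.coord j) (comul.rTensor O t) := by
        intro t
        induction t with
        | zero => simp
        | add y z hy hz => simp only [map_add, hy, hz]
        | tmul y z => simp
      have h2 : ∀ y ∈ M, ∀ w : O ⊗[k] O,
          slice (b.coord j) ((TensorProduct.assoc k O O O).symm (y ⊗ₜ w)) ∈ R := by
        intro y hy w
        induction w with
        | zero => simp
        | add v w hv hw => simp only [TensorProduct.tmul_add, map_add]; exact add_mem hv hw
        | tmul v w =>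
          simp only [TensorProduct.assoc_symm_tmul, slice_tmul]
          exact R.smul_mem _ ⟨⟨y, hy⟩ ⊗ₜ v, by simp⟩
      change comul (R := k) (u i j) ∈ R
      rw [hu', h1, ← coassoc_symm_apply, hu, Finsupp.sum, map_sum, map_sum, map_sum]
      exact sum_mem fun j' hj' ↦ h2 _ (huM i j' hj') _
  let e := LinearEquiv.ofInjective _ (subtype_rTensor_injective (k := k) M)
  let ρ : M →ₗ[k] M ⊗[k] O := e.symm.toLinearMap ∘ₗ
    LinearMap.codRestrict R (comul ∘ₗ M.subtype.restrictScalars k) fun m ↦ hR m m.2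
  refine ⟨M, Module.Finite.span_of_finite A hS, ⟨ρ, fun m ↦ ?_⟩, fun i ↦ ?_⟩
  · exact congrArg Subtype.val (e.apply_symm_apply _)
  · have h := lTensor_counit_comul (R := k) (x i)
    have h' := congrArg (TensorProduct.rid k O) h
    rw [TensorProduct.rid_tmul, one_smul, hu, Finsupp.sum, map_sum, map_sum] at h'
    rw [← h']
    refine sum_mem fun j hj ↦ ?_
    rw [LinearMap.lTensor_tmul, TensorProduct.rid_tmul, ← algebraMap_smul A]
    exact M.smul_mem _ (huM i j hj)

/-- A commutative Hopf algebra is flat over its Hopf subalgebras. -/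
theorem IsHopfSub.flat (hA : IsHopfSub k O A) : Module.Flat A O := by
  refine Module.Flat.iff_forall_isTrivialRelation.2 fun {r f x} hfx ↦ ?_
  obtain ⟨M, hM, ⟨ρ, hρ⟩, hx⟩ := exists_finite_subCoact hA x
  obtain ⟨a, ha, hε⟩ := exists_mem_factorIdeal hA hρ
  have h1 : M.subtype ∈ factorSpan M := by
    rw [← one_smul A M.subtype, ← mem_factorIdeal, factorIdeal_eq_top hA hρ ha hε]
    trivial
  have key : ∀ θ ∈ factorSpan M, ∃ (n : ℕ) (φ : Fin n → (M →ₗ[A] A)) (o : Fin n → O),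
      ∀ m, θ m = ∑ i, φ i m • o i := by
    intro θ hθ
    induction hθ using Submodule.span_induction with
    | zero => exact ⟨0, Fin.elim0, Fin.elim0, by simp⟩
    | add θ₁ θ₂ _ _ h₁ h₂ =>
      obtain ⟨n₁, φ₁, o₁, h₁⟩ := h₁
      obtain ⟨n₂, φ₂, o₂, h₂⟩ := h₂
      exact ⟨n₁ + n₂, Fin.append φ₁ φ₂, Fin.append o₁ o₂, by simp [Fin.sum_univ_add, h₁, h₂]⟩
    | smul a θ _ h =>
      obtain ⟨n, φ, o, h⟩ := h
      exact ⟨n, fun i ↦ a • φ i, o, by simp [h, Finset.smul_sum, mul_smul]⟩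
    | mem θ h =>
      obtain ⟨φ, hφ, o, rfl⟩ := h
      let φ' : M →ₗ[A] A :=
        { toFun := fun m ↦ ⟨φ m, hφ m⟩
          map_add' := fun m m' ↦ Subtype.ext (φ.map_add m m')
          map_smul' := fun a m ↦ Subtype.ext (φ.map_smul a m) }
      refine ⟨1, fun _ ↦ φ', fun _ ↦ o, fun m ↦ ?_⟩
      simp [Algebra.smul_def, mul_comm, φ']
  obtain ⟨n, φ, o, h⟩ := key _ h1
  refine ⟨n, fun i j ↦ φ j ⟨x i, hx i⟩, o, fun i ↦ h ⟨x i, hx i⟩, fun j ↦ ?_⟩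
  simp only [← smul_eq_mul, ← map_smul]
  have h2 : ∑ i, f i • (⟨x i, hx i⟩ : M) = 0 := Subtype.ext (by simpa using hfx)
  have h3 := congrArg (φ j) h2
  rwa [map_sum, map_zero] at h3

end Flatness

section Cotensor

variable {k : Type} [Field k] {O : Type} [CommRing O] [HopfAlgebra k O]
  {R : Type} [CommRing R] [Algebra k R] [Algebra R O] [IsScalarTower k R O]
  {L : Type} [CommRing L] [HopfAlgebra k L] {q : O →ₐc[k] L}

variable (R) in
/-- The image of `R` in `O` is closed under comultiplication and `q` is the quotient by its
augmentation ideal. -/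
structure IsBaseQuotient (q : O →ₐc[k] L) : Prop where
  exists_comul_eq (a : R) : ∃ t : R ⊗[k] R,
    TensorProduct.map (IsScalarTower.toAlgHom k R O).toLinearMap
      (IsScalarTower.toAlgHom k R O).toLinearMap t = comul (R := k) (algebraMap R O a)
  surj : Function.Surjective q
  ker : RingHom.ker (q : O →ₐ[k] L) =
    Ideal.span {x | x ∈ Set.range (algebraMap R O) ∧ counit (R := k) x = 0}

lemma IsBaseQuotient.apply_eq (hq : IsBaseQuotient R q) (a : R) :
    q (algebraMap R O a) = algebraMap k L (counit (R := k) (algebraMap R O a)) := by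
  have h : (algebraMap R O a) - algebraMap k O (counit (R := k) (algebraMap R O a)) ∈
      RingHom.ker (q : O →ₐ[k] L) := by
    rw [hq.ker]
    exact Ideal.subset_span
      ⟨⟨a - algebraMap k R _, by rw [map_sub, ← IsScalarTower.algebraMap_apply]⟩, by simp⟩
  rw [RingHom.mem_ker, map_sub, sub_eq_zero, AlgHom.commutes] at h
  exact h

/-- The left coaction `g ↦ g₂ ⊗ q(g₁)` of `L` on `O`, with swapped factors. -/
noncomputable def leftCoactAlg (q : O →ₐc[k] L) : O →ₐ[k] O ⊗[k] L :=
  ((Algebra.TensorProduct.map (AlgHom.id k O) (q : O →ₐ[k] L)).comp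
    (Algebra.TensorProduct.comm k O O).toAlgHom).comp (Bialgebra.comulAlgHom k O)

lemma leftCoactAlg_apply (g : O) :
    leftCoactAlg q g = (q : O →ₗ[k] L).lTensor O (TensorProduct.comm k O O (comul g)) := rfl

lemma leftCoactAlg_mem (hq : IsBaseQuotient R q) (a : R) :
    leftCoactAlg q (algebraMap R O a) = (algebraMap R O a) ⊗ₜ[k] 1 := by
  obtain ⟨t, ht⟩ := hq.exists_comul_eq a
  have h1 := congrArg (TensorProduct.lid k O) (rTensor_counit_comul (R := k) (algebraMap R O a))
  rw [TensorProduct.lid_tmul, one_smul] at h1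
  have h2 : (algebraMap R O a) ⊗ₜ[k] (1 : L) =
      TensorProduct.lid k O (counit.rTensor O (comul (R := k) (algebraMap R O a))) ⊗ₜ[k]
        (1 : L) := by
    rw [h1]
  rw [h2, leftCoactAlg_apply, ← ht]
  clear ht h1 h2
  induction t with
  | zero => simp
  | add x y hx hy => simp only [map_add, hx, hy, TensorProduct.add_tmul]
  | tmul x y =>
    simp only [TensorProduct.map_tmul, TensorProduct.comm_tmul, LinearMap.lTensor_tmul,
      LinearMap.rTensor_tmul, TensorProduct.lid_tmul, AlgHom.toLinearMap_apply]
    change algebraMap R O y ⊗ₜ[k] q (algebraMap R O x) = _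
    rw [hq.apply_eq, Algebra.algebraMap_eq_smul_one (A := L), TensorProduct.tmul_smul,
      TensorProduct.smul_tmul']
    rfl

/-- The `A`-linear map `g ↦ g₂ ⊗ q(g₁)`. -/
noncomputable def leftCoact (hq : IsBaseQuotient R q) :
    O →ₗ[R] O ⊗[k] L where
  toFun := leftCoactAlg q
  map_add' := map_add _
  map_smul' a g := by
    rw [Algebra.smul_def, map_mul]
    rw [leftCoactAlg_mem hq]
    generalize leftCoactAlg q g = z
    induction z with
    | zero => simp
    | add x y hx hy => rw [mul_add, hx, hy, smul_add]
    | tmul x y =>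
      rw [Algebra.TensorProduct.tmul_mul_tmul, one_mul, ← Algebra.smul_def, RingHom.id_apply,
        TensorProduct.smul_tmul']

variable (k R) in
/-- The algebra map `g ↦ ι(g₂) ⊗ g₁` from `O` to `O ⊗_A O`. -/
noncomputable def canInvAux : O →ₐ[k] O ⊗[R] O :=
  (Algebra.TensorProduct.productMap
    ((Algebra.TensorProduct.includeRight : O →ₐ[R] O ⊗[R] O).restrictScalars k)
    ((Algebra.TensorProduct.includeLeft : O →ₐ[k] O ⊗[R] O).comp (antipodeAlgHom k O))).comp
  (Bialgebra.comulAlgHom k O)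

variable (k R) in
/-- The linear map `u ⊗ h ↦ ι(h) ⊗ u`. -/
noncomputable def swapAntipode : O ⊗[k] O →ₗ[k] O ⊗[R] O :=
  (Algebra.TensorProduct.productMap
    ((Algebra.TensorProduct.includeRight : O →ₐ[R] O ⊗[R] O).restrictScalars k)
    ((Algebra.TensorProduct.includeLeft : O →ₐ[k] O ⊗[R] O).comp
      (antipodeAlgHom k O))).toLinearMap

lemma swapAntipode_tmul (u h : O) :
    swapAntipode k R (u ⊗ₜ[k] h) = antipode k h ⊗ₜ[R] u := by
  change ((1 : O) ⊗ₜ[R] u) * (antipode k h ⊗ₜ[R] (1 : O)) = _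
  simp

lemma canInvAux_apply (g : O) : canInvAux k R g = swapAntipode k R (comul (R := k) g) := rfl

lemma canInvAux_mem (hq : IsBaseQuotient R q) (a : R) :
    canInvAux k R (algebraMap R O a) = algebraMap k _ (counit (R := k) (algebraMap R O a)) := by
  obtain ⟨t, ht⟩ := hq.exists_comul_eq a
  have h1 := mul_antipode_lTensor_comul_apply (R := k) (algebraMap R O a)
  have h2 : algebraMap k (O ⊗[R] O) (counit (R := k) (algebraMap R O a)) =
      algebraMap k O (counit (R := k) (algebraMap R O a)) ⊗ₜ[R] 1 := rfl
  rw [h2, ← h1, canInvAux_apply, ← ht]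
  clear ht h1 h2
  induction t with
  | zero => simp
  | add x y hx hy => simp only [map_add, hx, hy, TensorProduct.add_tmul]
  | tmul x y =>
    simp only [TensorProduct.map_tmul, swapAntipode_tmul, LinearMap.lTensor_tmul,
      LinearMap.mul'_apply, AlgHom.toLinearMap_apply]
    change antipode k (algebraMap R O y) ⊗ₜ[R] algebraMap R O x =
      (algebraMap R O x * antipode k (algebraMap R O y)) ⊗ₜ[R] 1
    have h3 : algebraMap R O x = x • (1 : O) := by simp [Algebra.smul_def]
    conv_lhs => rw [h3, ← TensorProduct.smul_tmul]
    rw [Algebra.smul_def]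

lemma exists_canInv (hq : IsBaseQuotient R q) :
    ∃ κ : L →ₗ[k] O ⊗[R] O, ∀ g, κ (q g) = canInvAux k R g := by
  have hker : LinearMap.ker (q : O →ₗ[k] L) ≤ LinearMap.ker (canInvAux k R).toLinearMap := by
    have h : RingHom.ker (q : O →ₐ[k] L) ≤ RingHom.ker (canInvAux k R) := by
      rw [hq.ker, Ideal.span_le]
      rintro _ ⟨⟨a, rfl⟩, ha'⟩
      simpa [ha'] using canInvAux_mem hq a
    exact h
  refine ⟨(LinearMap.ker (q : O →ₗ[k] L)).liftQ _ hker ∘ₗ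
    ((q : O →ₗ[k] L).quotKerEquivOfSurjective hq.surj).symm.toLinearMap, fun g ↦ ?_⟩
  have : ((q : O →ₗ[k] L).quotKerEquivOfSurjective hq.surj).symm (q g) =
      Submodule.Quotient.mk g := by
    rw [LinearEquiv.symm_apply_eq]
    rfl
  rw [LinearMap.comp_apply, LinearEquiv.coe_coe, this]
  rfl

/-- `Σ g₃ι(g₂) ⊗ g₁ = 1 ⊗ g`. -/
lemma liftBaseChange_canInvAux (g : O) :
    (canInvAux k R).toLinearMap.liftBaseChange O (TensorProduct.comm k O O (comul g)) =
      1 ⊗ₜ[R] g := by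
  have h1 : ∀ t : O ⊗[k] O, (canInvAux k R).toLinearMap.liftBaseChange O
      (TensorProduct.comm k O O t) =
      TensorProduct.lift ((TensorProduct.mk R O O).restrictScalars₁₂ k k).flip
        ((LinearMap.mul' k O ∘ₗ (antipode k).rTensor O).lTensor O
          (TensorProduct.assoc k O O O (comul.rTensor O t))) := by
    intro t
    induction t with
    | zero => simp
    | add a b ha hb => simp only [map_add, ha, hb]
    | tmul u h =>
      rw [TensorProduct.comm_tmul, LinearMap.liftBaseChange_tmul, AlgHom.toLinearMap_apply,
        canInvAux_apply, LinearMap.rTensor_tmul]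
      generalize comul (R := k) u = w
      induction w with
      | zero => simp
      | add a b ha hb => simp only [map_add, smul_add, TensorProduct.add_tmul, ha, hb]
      | tmul a b => simp [swapAntipode_tmul, TensorProduct.smul_tmul', mul_comm]
  rw [h1, coassoc_apply, ← LinearMap.comp_apply (LinearMap.lTensor _ _), ← LinearMap.lTensor_comp]
  have h2 : (LinearMap.mul' k O ∘ₗ (antipode k).rTensor O) ∘ₗ comul =
      Algebra.linearMap k O ∘ₗ counit := by
    ext y; simp
  rw [h2, LinearMap.lTensor_comp, LinearMap.comp_apply, lTensor_counit_comul]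
  simp

lemma lmul'_canInvAux (g : O) :
    Algebra.TensorProduct.lmul' R (canInvAux k R g) = algebraMap k O (counit (R := k) g) := by
  rw [← mul_antipode_lTensor_comul_apply, canInvAux_apply]
  generalize comul (R := k) g = t
  induction t with
  | zero => simp
  | add x y hx hy => simp only [map_add, hx, hy]
  | tmul x y => simp [swapAntipode_tmul, mul_comm]

/-- The coaction `x ⊗ g ↦ (x ⊗ g₂) ⊗ q(g₁)` on `O ⊗_A O`. -/
noncomputable def baseCoact (hq : IsBaseQuotient R q) :
    O ⊗[R] O →ₗ[O] (O ⊗[R] O) ⊗[k] L :=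
  (TensorProduct.AlgebraTensorModule.assoc k R O O O L).symm.toLinearMap ∘ₗ
    TensorProduct.AlgebraTensorModule.lTensor O O (leftCoact hq)

lemma baseCoact_canInvAux (hq : IsBaseQuotient R q) (g : O) :
    baseCoact hq (canInvAux k R g) =
      TensorProduct.map (canInvAux k R).toLinearMap (q : O →ₗ[k] L)
        (TensorProduct.comm k O O (comul g)) := by
  let Ψ : O ⊗[k] (O ⊗[k] O) →ₗ[k] (O ⊗[R] O) ⊗[k] L :=
    TensorProduct.map (swapAntipode k R) (q : O →ₗ[k] L) ∘ₗ
      (TensorProduct.comm k O (O ⊗[k] O)).toLinearMap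
  have h1 : ∀ t : O ⊗[k] O, baseCoact hq (swapAntipode k R t) =
      Ψ (TensorProduct.assoc k O O O (comul.rTensor O t)) := by
    intro t
    induction t with
    | zero => simp
    | add a b ha hb => simp only [map_add, ha, hb]
    | tmul u h =>
      rw [swapAntipode_tmul, LinearMap.rTensor_tmul]
      change (TensorProduct.AlgebraTensorModule.assoc k R O O O L).symm
        (antipode k h ⊗ₜ[R] leftCoactAlg q u) = _
      rw [leftCoactAlg_apply]
      generalize comul (R := k) u = w
      induction w with
      | zero =>
        rw [map_zero, map_zero, TensorProduct.tmul_zero, LinearEquiv.map_zero,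
          TensorProduct.zero_tmul, map_zero, map_zero]
      | add a b ha hb =>
        rw [map_add, map_add, TensorProduct.tmul_add, LinearEquiv.map_add, ha, hb,
          TensorProduct.add_tmul, map_add, map_add]
      | tmul a b => simp [swapAntipode_tmul, Ψ]
  have h2 : ∀ t : O ⊗[k] O, TensorProduct.map (canInvAux k R).toLinearMap (q : O →ₗ[k] L)
        (TensorProduct.comm k O O t) = Ψ (comul.lTensor O t) := by
    intro t
    induction t with
    | zero => simp
    | add a b ha hb => simp only [map_add, ha, hb]
    | tmul u h => simp [Ψ, canInvAux_apply]
  rw [canInvAux_apply, h1, h2, coassoc_apply]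

variable {U : Type} [AddCommGroup U] [Module k U]

/-- The difference of the two maps `O ⊗ U → O ⊗ (L ⊗ U)` whose equalizer is the cotensor product
with swapped factors; here `ρ` is the swapped coaction of `U`. -/
noncomputable def swappedObstruction (hq : IsBaseQuotient R q)
    (ρ : U →ₗ[k] L ⊗[k] U) : O ⊗[k] U →ₗ[R] O ⊗[k] (L ⊗[k] U) :=
  TensorProduct.AlgebraTensorModule.lTensor R O ρ -
    (TensorProduct.AlgebraTensorModule.assoc k k R O L U).toLinearMap ∘ₗ
      TensorProduct.AlgebraTensorModule.rTensor k U (leftCoact hq)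

/-- The `O`-linear map `h ⊗ u ↦ h • κ(u₁) ⊗ u₀`, which inverts multiplication. -/
noncomputable def canInv (R : Type) [CommRing R] [Algebra k R] [Algebra R O] [IsScalarTower k R O]
     (κ : L →ₗ[k] O ⊗[R] O) (ρ : U →ₗ[k] L ⊗[k] U) :
    O ⊗[k] U →ₗ[O] O ⊗[R] (O ⊗[k] U) :=
  ((TensorProduct.AlgebraTensorModule.assoc k R O O O U).toLinearMap ∘ₗ
    (κ.rTensor U).liftBaseChange O) ∘ₗ TensorProduct.AlgebraTensorModule.lTensor O O ρ

lemma liftBaseChange_leftCoactAlg {κ : L →ₗ[k] O ⊗[R] O} (hκ : ∀ g, κ (q g) = canInvAux k R g)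
    (g : O) : κ.liftBaseChange O (leftCoactAlg q g) = 1 ⊗ₜ[R] g := by
  rw [← liftBaseChange_canInvAux (k := k), leftCoactAlg_apply]
  generalize TensorProduct.comm k O O (comul g) = t
  induction t with
  | zero => simp
  | add x y hx hy => simp only [map_add, hx, hy]
  | tmul x y =>
    rw [LinearMap.lTensor_tmul, LinearMap.liftBaseChange_tmul, LinearMap.liftBaseChange_tmul]
    exact congrArg (x • ·) (hκ y)

lemma canInv_of_mem_ker (hq : IsBaseQuotient R q)
    {κ : L →ₗ[k] O ⊗[R] O} (hκ : ∀ g, κ (q g) = canInvAux k R g) (ρ : U →ₗ[k] L ⊗[k] U)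
    {c : O ⊗[k] U} (hc : c ∈ LinearMap.ker (swappedObstruction hq ρ)) :
    canInv R κ ρ c = 1 ⊗ₜ[R] c := by
  have h1 : ∀ (z : O ⊗[k] L) (u : U), (κ.rTensor U).liftBaseChange O
      (TensorProduct.assoc k O L U (z ⊗ₜ[k] u)) = κ.liftBaseChange O z ⊗ₜ[k] u := by
    intro z u
    induction z with
    | zero => simp
    | add x y hx hy => simp only [map_add, TensorProduct.add_tmul, hx, hy]
    | tmul x y => simp [TensorProduct.smul_tmul']
  have h2 : ∀ c : O ⊗[k] U, TensorProduct.AlgebraTensorModule.assoc k R O O O U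
      ((κ.rTensor U).liftBaseChange O (TensorProduct.AlgebraTensorModule.assoc k k R O L U
        (TensorProduct.AlgebraTensorModule.rTensor k U (leftCoact hq) c))) = 1 ⊗ₜ[R] c := by
    intro c
    induction c with
    | zero => simp
    | add x y hx hy => simp only [map_add, TensorProduct.tmul_add, hx, hy]
    | tmul g u =>
      have := h1 (leftCoactAlg q g) u
      rw [liftBaseChange_leftCoactAlg hκ] at this
      exact congrArg (TensorProduct.AlgebraTensorModule.assoc k R O O O U) this
  rw [← h2 c]
  rw [LinearMap.mem_ker, swappedObstruction, LinearMap.sub_apply, sub_eq_zero] at hc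
  exact congrArg (fun x ↦ TensorProduct.AlgebraTensorModule.assoc k R O O O U
    ((κ.rTensor U).liftBaseChange O x)) hc

lemma baseCoact_canInv (hq : IsBaseQuotient R q)
    {κ : L →ₗ[k] O ⊗[R] O} (hκ : ∀ g, κ (q g) = canInvAux k R g) (l : L) :
    baseCoact hq (κ l) = κ.rTensor L (TensorProduct.comm k L L (comul l)) := by
  obtain ⟨g, rfl⟩ := hq.surj l
  have h1 : comul (R := k) (q g) = TensorProduct.map (q : O →ₗ[k] L) (q : O →ₗ[k] L)
      (comul (R := k) g) := (CoalgHomClass.map_comp_comul_apply q g).symm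
  rw [hκ, baseCoact_canInvAux, h1]
  generalize comul (R := k) g = t
  induction t with
  | zero => simp
  | add x y hx hy => simp only [map_add, hx, hy]
  | tmul x y =>
    simp only [TensorProduct.map_tmul, TensorProduct.comm_tmul, LinearMap.rTensor_tmul]
    exact congrArg (· ⊗ₜ[k] _) (hκ y).symm

lemma swapped_coassoc {ρU : U →ₗ[k] U ⊗[k] L} (hU : IsComod k L ρU) (u : U) :
    ((TensorProduct.comm k U L).toLinearMap ∘ₗ ρU).lTensor L (TensorProduct.comm k U L (ρU u)) =
      TensorProduct.assoc k L L U (((TensorProduct.comm k L L).toLinearMap ∘ₗ comul).rTensor U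
        (TensorProduct.comm k U L (ρU u))) := by
  let θ : U ⊗[k] (L ⊗[k] L) →ₗ[k] L ⊗[k] (L ⊗[k] U) :=
    (TensorProduct.assoc k L L U).toLinearMap ∘ₗ
      (TensorProduct.comm k L L).toLinearMap.rTensor U ∘ₗ
        (TensorProduct.comm k U (L ⊗[k] L)).toLinearMap
  have h1 : ∀ t : U ⊗[k] L, ((TensorProduct.comm k U L).toLinearMap ∘ₗ ρU).lTensor L
      (TensorProduct.comm k U L t) =
      θ (TensorProduct.assoc k U L L (TensorProduct.map ρU LinearMap.id t)) := by
    intro t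
    induction t with
    | zero => simp
    | add x y hx hy => simp only [map_add, hx, hy]
    | tmul u l =>
      simp only [TensorProduct.comm_tmul, LinearMap.lTensor_tmul, TensorProduct.map_tmul,
        LinearMap.comp_apply, LinearMap.id_apply, LinearEquiv.coe_coe]
      generalize ρU u = s
      induction s with
      | zero => simp
      | add x y hx hy => simp only [map_add, TensorProduct.add_tmul, TensorProduct.tmul_add, hx, hy]
      | tmul v m => simp [θ]
  have h2 : ∀ t : U ⊗[k] L, TensorProduct.assoc k L L U
      (((TensorProduct.comm k L L).toLinearMap ∘ₗ comul).rTensor U (TensorProduct.comm k U L t)) =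
      θ (TensorProduct.map LinearMap.id comul t) := by
    intro t
    induction t with
    | zero => simp
    | add x y hx hy => simp only [map_add, hx, hy]
    | tmul u l => simp [θ]
  rw [h1, h2, hU.coassoc]

lemma baseChange_swappedObstruction_assoc (hq : IsBaseQuotient R q)
    (ρ : U →ₗ[k] L ⊗[k] U) (w : O ⊗[R] O) (u : U) :
    (swappedObstruction hq ρ).baseChange O
        (TensorProduct.AlgebraTensorModule.assoc k R O O O U (w ⊗ₜ[k] u)) =
      TensorProduct.AlgebraTensorModule.assoc k R O O O (L ⊗[k] U)
        (w ⊗ₜ[k] ρ u - TensorProduct.assoc k _ L U (baseCoact hq w ⊗ₜ[k] u)) := by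
  induction w with
  | zero => simp
  | add x y hx hy =>
    simp only [map_add, TensorProduct.add_tmul, hx, hy]
    rw [← map_add]
    congr 1
    abel
  | tmul x g =>
    have h1 : ∀ z : O ⊗[k] L, x ⊗ₜ[R] TensorProduct.assoc k O L U (z ⊗ₜ[k] u) =
        TensorProduct.AlgebraTensorModule.assoc k R O O O (L ⊗[k] U)
          (TensorProduct.assoc k _ L U
            ((TensorProduct.AlgebraTensorModule.assoc k R O O O L).symm (x ⊗ₜ[R] z) ⊗ₜ[k] u)) := by
      intro z
      induction z with
      | zero => simp
      | add a b ha hb => simp only [map_add, TensorProduct.add_tmul, TensorProduct.tmul_add, ha, hb]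
      | tmul a b => simp
    have h2 := h1 (leftCoactAlg q g)
    rw [map_sub, TensorProduct.AlgebraTensorModule.assoc_tmul, LinearMap.baseChange_tmul,
      swappedObstruction, LinearMap.sub_apply, TensorProduct.tmul_sub,
      TensorProduct.AlgebraTensorModule.lTensor_tmul,
      TensorProduct.AlgebraTensorModule.assoc_tmul]
    exact congrArg _ h2

lemma baseChange_swappedObstruction_canInv (hq : IsBaseQuotient R q)
    {κ : L →ₗ[k] O ⊗[R] O} (hκ : ∀ g, κ (q g) = canInvAux k R g)
    {ρU : U →ₗ[k] U ⊗[k] L} (hU : IsComod k L ρU) (y : O ⊗[k] U) :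
    (swappedObstruction hq ((TensorProduct.comm k U L).toLinearMap ∘ₗ ρU)).baseChange O
      (canInv R κ ((TensorProduct.comm k U L).toLinearMap ∘ₗ ρU) y) = 0 := by
  set ρ := (TensorProduct.comm k U L).toLinearMap ∘ₗ ρU with hρ
  induction y with
  | zero => simp
  | add x y hx hy => rw [map_add, map_add, hx, hy, add_zero]
  | tmul h u =>
    have h1 : h ⊗ₜ[k] u = h • ((1 : O) ⊗ₜ[k] u) := by simp [TensorProduct.smul_tmul']
    have h2 : ∀ s : L ⊗[k] U, (swappedObstruction hq ρ).baseChange O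
        (TensorProduct.AlgebraTensorModule.assoc k R O O O U (κ.rTensor U s)) =
        TensorProduct.AlgebraTensorModule.assoc k R O O O (L ⊗[k] U)
          (κ.rTensor (L ⊗[k] U) (ρ.lTensor L s - TensorProduct.assoc k L L U
            (((TensorProduct.comm k L L).toLinearMap ∘ₗ comul).rTensor U s))) := by
      intro s
      induction s with
      | zero => simp
      | add a b ha hb =>
        simp only [map_add, ha, hb]
        rw [← map_add, ← map_add]
        congr 2
        abel
      | tmul l v =>
        rw [LinearMap.rTensor_tmul, baseChange_swappedObstruction_assoc, baseCoact_canInv hq hκ,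
          map_sub (κ.rTensor (L ⊗[k] U)), LinearMap.lTensor_tmul, LinearMap.rTensor_tmul,
          LinearMap.rTensor_tmul]
        congr 2
        change _ = κ.rTensor (L ⊗[k] U) (TensorProduct.assoc k L L U
          (TensorProduct.comm k L L (comul l) ⊗ₜ[k] v))
        generalize TensorProduct.comm k L L (comul l) = w
        induction w with
        | zero => simp
        | add a b ha hb => simp only [map_add, TensorProduct.add_tmul, ha, hb]
        | tmul a b => simp
    rw [h1, map_smul, map_smul, canInv, LinearMap.comp_apply, LinearMap.comp_apply,
      TensorProduct.AlgebraTensorModule.lTensor_tmul, LinearMap.liftBaseChange_tmul, one_smul,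
      LinearEquiv.coe_coe, h2]
    have h3 := swapped_coassoc hU u
    rw [← hρ] at h3
    rw [show ρ u = TensorProduct.comm k U L (ρU u) from rfl, h3, sub_self, map_zero, map_zero,
      smul_zero]

lemma liftBaseChange_id_canInv (hq : IsBaseQuotient R q)
    {κ : L →ₗ[k] O ⊗[R] O} (hκ : ∀ g, κ (q g) = canInvAux k R g)
    {ρU : U →ₗ[k] U ⊗[k] L} (hU : IsComod k L ρU) (y : O ⊗[k] U) :
    (LinearMap.id : O ⊗[k] U →ₗ[R] O ⊗[k] U).liftBaseChange O
      (canInv R κ ((TensorProduct.comm k U L).toLinearMap ∘ₗ ρU) y) = y := by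
  have h1 : ∀ (w : O ⊗[R] O) (u : U),
      (LinearMap.id : O ⊗[k] U →ₗ[R] O ⊗[k] U).liftBaseChange O
        (TensorProduct.AlgebraTensorModule.assoc k R O O O U (w ⊗ₜ[k] u)) =
      Algebra.TensorProduct.lmul' R w ⊗ₜ[k] u := by
    intro w u
    induction w with
    | zero => simp
    | add a b ha hb => simp only [map_add, TensorProduct.add_tmul, ha, hb]
    | tmul a b => simp [TensorProduct.smul_tmul']
  have h2 : ∀ l : L, Algebra.TensorProduct.lmul' R (κ l) =
      algebraMap k O (counit (R := k) l) := by
    intro l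
    obtain ⟨g, rfl⟩ := hq.surj l
    rw [hκ, lmul'_canInvAux, CoalgHomClass.counit_comp_apply]
  have h3 : ∀ t : U ⊗[k] L, (LinearMap.id : O ⊗[k] U →ₗ[R] O ⊗[k] U).liftBaseChange O
        (TensorProduct.AlgebraTensorModule.assoc k R O O O U
          (κ.rTensor U (TensorProduct.comm k U L t))) =
      1 ⊗ₜ[k] TensorProduct.rid k U (TensorProduct.map LinearMap.id counit t) := by
    intro t
    induction t with
    | zero => simp
    | add a b ha hb => simp only [map_add, TensorProduct.tmul_add, ha, hb]
    | tmul u l =>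
      rw [TensorProduct.comm_tmul, LinearMap.rTensor_tmul, h1, h2]
      simp [Algebra.algebraMap_eq_smul_one, TensorProduct.smul_tmul']
  induction y with
  | zero => simp
  | add a b ha hb => rw [map_add, map_add, ha, hb]
  | tmul h u =>
    have h4 : h ⊗ₜ[k] u = h • ((1 : O) ⊗ₜ[k] u) := by simp [TensorProduct.smul_tmul']
    have h5 := h3 (ρU u)
    rw [hU.counit] at h5
    rw [h4, map_smul, map_smul, canInv, LinearMap.comp_apply, LinearMap.comp_apply,
      TensorProduct.AlgebraTensorModule.lTensor_tmul, LinearMap.liftBaseChange_tmul, one_smul]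
    exact congrArg (h • ·) h5

lemma exists_lTensor_ker_subtype_eq {S M N P : Type} [CommRing S] [CommRing M] [Algebra S M]
    [Module.Flat S M] [AddCommGroup N] [AddCommGroup P] [Module S N] [Module S P] (d : N →ₗ[S] P)
    (x : M ⊗[S] N) (hx : d.baseChange M x = 0) :
    ∃ z, (LinearMap.ker d).subtype.lTensor M z = x :=
  (Module.Flat.lTensor_exact M (LinearMap.exact_subtype_ker_map d) x).1 hx

/-- Multiplication `O ⊗_R C → O ⊗ U` is bijective, where `C ⊆ O ⊗ U` is the swapped cotensor
product. -/
lemma liftBaseChange_ker_bijective [Module.Flat R O] (hq : IsBaseQuotient R q)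
    {ρU : U →ₗ[k] U ⊗[k] L} (hU : IsComod k L ρU) :
    Function.Bijective ((LinearMap.ker (swappedObstruction hq
      ((TensorProduct.comm k U L).toLinearMap ∘ₗ ρU))).subtype.liftBaseChange O) := by
  obtain ⟨κ, hκ⟩ := exists_canInv hq
  set ρ := (TensorProduct.comm k U L).toLinearMap ∘ₗ ρU with hρ
  set d := swappedObstruction hq ρ with hd
  have h1 : ∀ z, canInv R κ ρ ((LinearMap.ker d).subtype.liftBaseChange O z) =
      (LinearMap.ker d).subtype.lTensor O z := by
    intro z
    induction z with
    | zero => simp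
    | add a b ha hb => rw [map_add, map_add, map_add, ha, hb]
    | tmul h c =>
      rw [LinearMap.liftBaseChange_tmul, map_smul, Submodule.subtype_apply,
        canInv_of_mem_ker hq hκ ρ c.2, TensorProduct.smul_tmul', smul_eq_mul, mul_one]
      rfl
  constructor
  · have h2 := Module.Flat.lTensor_preserves_injective_linearMap (M := O) (LinearMap.ker d).subtype
      (LinearMap.ker d).injective_subtype
    intro x y hxy
    apply h2
    rw [← h1, ← h1, hxy]
  · intro y
    obtain ⟨z, hz⟩ := exists_lTensor_ker_subtype_eq d _
      (baseChange_swappedObstruction_canInv hq hκ hU y)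
    refine ⟨z, ?_⟩
    rw [← liftBaseChange_id_canInv hq hκ hU y, ← hρ, ← hz]
    generalize z = z
    induction z with
    | zero => simp
    | add a b ha hb => rw [map_add, map_add, map_add, ha, hb]
    | tmul h c => simp

lemma mem_cotensor_iff (hq : IsBaseQuotient R q) (ρU : U →ₗ[k] U ⊗[k] L) (x : U ⊗[k] O) :
    x ∈ cotensor k (q : O →ₗ[k] L) ρU ↔ TensorProduct.comm k U O x ∈
      LinearMap.ker (swappedObstruction hq ((TensorProduct.comm k U L).toLinearMap ∘ₗ ρU)) := by
  let e : U ⊗[k] (L ⊗[k] O) ≃ₗ[k] O ⊗[k] (L ⊗[k] U) :=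
    TensorProduct.comm k U (L ⊗[k] O) ≪≫ₗ TensorProduct.assoc k L O U ≪≫ₗ
      TensorProduct.leftComm k L O U
  have h1 : ∀ (s : U ⊗[k] L) (g : O), e (TensorProduct.assoc k U L O (s ⊗ₜ[k] g)) =
      g ⊗ₜ[k] TensorProduct.comm k U L s := by
    intro s g
    induction s with
    | zero => simp
    | add a b ha hb => simp only [map_add, TensorProduct.add_tmul, TensorProduct.tmul_add, ha, hb]
    | tmul a b => simp [e]
  have h2 : ∀ (t : O ⊗[k] O) (u : U),
      e (u ⊗ₜ[k] TensorProduct.map (q : O →ₗ[k] L) LinearMap.id t) =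
      TensorProduct.assoc k O L U
        ((q : O →ₗ[k] L).lTensor O (TensorProduct.comm k O O t) ⊗ₜ[k] u) := by
    intro t u
    induction t with
    | zero => simp
    | add a b ha hb => simp only [map_add, TensorProduct.add_tmul, TensorProduct.tmul_add, ha, hb]
    | tmul a b => simp [e]
  have h3 : e (cotensorObstruction k (q : O →ₗ[k] L) ρU x) =
      swappedObstruction hq ((TensorProduct.comm k U L).toLinearMap ∘ₗ ρU)
        (TensorProduct.comm k U O x) := by
    induction x with
    | zero => simp
    | add a b ha hb => simp only [map_add, ha, hb]
    | tmul u g =>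
      rw [cotensorObstruction, LinearMap.sub_apply, map_sub]
      exact congrArg₂ (· - ·) (h1 (ρU u) g) (h2 (comul g) u)
  rw [LinearMap.mem_ker, ← h3, cotensor, LinearMap.mem_ker, LinearEquiv.map_eq_zero_iff]

lemma comm_lTensor_mulRight (a : R) (x : U ⊗[k] O) :
    TensorProduct.comm k U O ((LinearMap.mulRight k (algebraMap R O a)).lTensor U x) =
      a • TensorProduct.comm k U O x := by
  induction x with
  | zero => simp
  | add a b ha hb => simp only [map_add, smul_add, ha, hb]
  | tmul u g => simp [TensorProduct.smul_tmul', Algebra.smul_def, mul_comm]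

/-- The canonical map `D ⊗_k O → O ⊗_R D` kills exactly the `R`-balancing relations; the
`R`-module structure on `D` is transported from `C` along `c`. -/
lemma ker_lift_mk_flip {C D : Type} [AddCommGroup C] [Module k C] [Module R C]
    [IsScalarTower k R C] [AddCommGroup D] [Module k D] (c : D ≃ₗ[k] C) :
    LinearMap.ker (TensorProduct.lift
        (((TensorProduct.mk R O C).restrictScalars₁₂ k k).flip ∘ₗ c.toLinearMap)) =
      Submodule.span k {z : D ⊗[k] O | ∃ (x : D) (a : R) (h : O),
        z = c.symm (a • c x) ⊗ₜ[k] h - x ⊗ₜ[k] (algebraMap R O a * h)} := by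
  set p := TensorProduct.lift
    (((TensorProduct.mk R O C).restrictScalars₁₂ k k).flip ∘ₗ c.toLinearMap)
  have hp : ∀ x h, p (x ⊗ₜ[k] h) = h ⊗ₜ[R] c x := fun _ _ ↦ rfl
  apply le_antisymm
  · intro z hz
    set S := Submodule.span k {z : D ⊗[k] O | ∃ (x : D) (a : R) (h : O),
      z = c.symm (a • c x) ⊗ₜ[k] h - x ⊗ₜ[k] (algebraMap R O a * h)} with hS
    let f : O →ₗ[k] C →ₗ[k] (D ⊗[k] O) ⧸ S :=
      ((TensorProduct.mk k D O).compr₂ S.mkQ ∘ₗ c.symm.toLinearMap).flip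
    let s : O ⊗[R] C →+ (D ⊗[k] O) ⧸ S := TensorProduct.liftAddHom
      (AddMonoidHom.mk' (fun h ↦ (f h).toAddMonoidHom) fun a b ↦ by ext; simp) <| by
        intro a h x
        change S.mkQ (c.symm x ⊗ₜ[k] (a • h)) = S.mkQ (c.symm (a • x) ⊗ₜ[k] h)
        symm
        rw [← sub_eq_zero, ← map_sub, Submodule.mkQ_apply, Submodule.Quotient.mk_eq_zero]
        refine Submodule.subset_span ⟨c.symm x, a, h, ?_⟩
        rw [Algebra.smul_def, c.apply_symm_apply]
    have hs : ∀ z, s (p z) = S.mkQ z := by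
      intro z
      induction z with
      | zero => simp
      | add a b ha hb => rw [map_add, map_add, map_add, ha, hb]
      | tmul x h =>
        change S.mkQ (c.symm (c x) ⊗ₜ[k] h) = _
        rw [c.symm_apply_apply]
    rw [← Submodule.Quotient.mk_eq_zero, ← Submodule.mkQ_apply, ← hs, LinearMap.mem_ker.1 hz,
      map_zero]
  · rw [Submodule.span_le]
    rintro _ ⟨x, a, h, rfl⟩
    rw [SetLike.mem_coe, LinearMap.mem_ker, map_sub, hp, hp, c.apply_symm_apply,
      ← Algebra.smul_def, TensorProduct.smul_tmul, sub_self]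

theorem cotensor_mul_bijective [Module.Flat R O] (hq : IsBaseQuotient R q)
    {ρU : U →ₗ[k] U ⊗[k] L} (hU : IsComod k L ρU) :
    ∃ H : ∀ (a : R) (x : cotensor k (q : O →ₗ[k] L) ρU),
        (LinearMap.lTensor U (LinearMap.mulRight k (algebraMap R O a))) (x : U ⊗[k] O) ∈
          cotensor k (q : O →ₗ[k] L) ρU,
      LinearMap.ker
          ((multMap k O U) ∘ₗ
            LinearMap.rTensor O (cotensor k (q : O →ₗ[k] L) ρU).subtype) =
        Submodule.span k
          {z : ↥(cotensor k (q : O →ₗ[k] L) ρU) ⊗[k] O |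
            ∃ (x : cotensor k (q : O →ₗ[k] L) ρU) (a : R) (h : O),
              z = (⟨(LinearMap.lTensor U (LinearMap.mulRight k (algebraMap R O a)))
                      (x : U ⊗[k] O), H a x⟩ : cotensor k (q : O →ₗ[k] L) ρU) ⊗ₜ[k] h
                  - x ⊗ₜ[k] (algebraMap R O a * h)} ∧
        LinearMap.range
          ((multMap k O U) ∘ₗ
            LinearMap.rTensor O (cotensor k (q : O →ₗ[k] L) ρU).subtype) = ⊤ := by
  have H : ∀ (a : R) (x : cotensor k (q : O →ₗ[k] L) ρU),
      (LinearMap.lTensor U (LinearMap.mulRight k (algebraMap R O a))) (x : U ⊗[k] O) ∈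
        cotensor k (q : O →ₗ[k] L) ρU := by
    intro a x
    rw [mem_cotensor_iff hq, comm_lTensor_mulRight]
    exact Submodule.smul_mem _ _ ((mem_cotensor_iff hq _ _).1 x.2)
  refine ⟨H, ?_⟩
  obtain ⟨hinj, hsurj⟩ := liftBaseChange_ker_bijective hq hU
  have hmem := mem_cotensor_iff hq ρU
  generalize LinearMap.ker (swappedObstruction hq
    ((TensorProduct.comm k U L).toLinearMap ∘ₗ ρU)) = C at hinj hsurj hmem
  generalize cotensor k (q : O →ₗ[k] L) ρU = D at H hmem
  let c : D ≃ₗ[k] C :=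
    { toFun := fun x ↦ ⟨TensorProduct.comm k U O x, (hmem _).1 x.2⟩
      invFun := fun x ↦ ⟨(TensorProduct.comm k U O).symm x, (hmem _).2 (by simp)⟩
      left_inv := fun x ↦ Subtype.ext (by simp)
      right_inv := fun x ↦ Subtype.ext (by simp)
      map_add' := fun x y ↦ Subtype.ext (map_add _ _ _)
      map_smul' := fun r x ↦ Subtype.ext (map_smul _ _ _) }
  have hact : ∀ (a : R) (x : D),
      c ⟨(LinearMap.mulRight k (algebraMap R O a)).lTensor U x, H a x⟩ = a • c x :=
    fun a x ↦ Subtype.ext (comm_lTensor_mulRight a (x : U ⊗[k] O))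
  let p : D ⊗[k] O →ₗ[k] O ⊗[R] C :=
    TensorProduct.lift (((TensorProduct.mk R O C).restrictScalars₁₂ k k).flip ∘ₗ c.toLinearMap)
  have hp : ∀ x h, p (x ⊗ₜ[k] h) = h ⊗ₜ[R] c x := fun _ _ ↦ rfl
  have hmul : ∀ z, TensorProduct.comm k U O ((multMap k O U ∘ₗ D.subtype.rTensor O) z) =
      C.subtype.liftBaseChange O (p z) := by
    have h1 : ∀ (x : U ⊗[k] O) (h : O), TensorProduct.comm k U O (multMap k O U (x ⊗ₜ[k] h)) =
        h • TensorProduct.comm k U O x := by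
      intro x h
      induction x with
      | zero => simp
      | add a b ha hb => simp only [map_add, TensorProduct.add_tmul, smul_add, ha, hb]
      | tmul u g => simp [multMap, TensorProduct.smul_tmul', mul_comm]
    intro z
    induction z with
    | zero => simp
    | add a b ha hb => rw [map_add, map_add, map_add, map_add, ha, hb]
    | tmul x h =>
      rw [hp, LinearMap.liftBaseChange_tmul]
      exact h1 x h
  have hpsurj : ∀ w, ∃ z, p z = w := by
    intro w
    induction w with
    | zero => exact ⟨0, map_zero _⟩
    | add a b ha hb =>
      obtain ⟨x, rfl⟩ := ha
      obtain ⟨y, rfl⟩ := hb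
      exact ⟨x + y, map_add _ _ _⟩
    | tmul h x => exact ⟨c.symm x ⊗ₜ h, by rw [hp, c.apply_symm_apply]⟩
  constructor
  · have hker := ker_lift_mk_flip (R := R) (O := O) (C := C) (D := D) c
    simp only [← hact, c.symm_apply_apply] at hker
    rw [← hker]
    ext z
    rw [LinearMap.mem_ker, LinearMap.mem_ker, ← (TensorProduct.comm k U O).map_eq_zero_iff, hmul,
      map_eq_zero_iff _ hinj]
  · rw [LinearMap.range_eq_top]
    intro y
    obtain ⟨w, hw⟩ := hsurj (TensorProduct.comm k U O y)
    obtain ⟨z, rfl⟩ := hpsurj w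
    refine ⟨z, (TensorProduct.comm k U O).injective ?_⟩
    rw [hmul, hw]

lemma IsQuotientHopf.isBaseQuotient {A : Subalgebra k O} (hA : IsHopfSub k O A)
    (hq : IsQuotientHopf k O L A q) : IsBaseQuotient A q where
  exists_comul_eq a := hA.exists_comul_eq a a.2
  surj := hq.surj
  ker := by
    rw [hq.ker]
    congr 1
    ext x
    exact and_congr_left fun _ ↦ ⟨fun h ↦ ⟨⟨x, h⟩, rfl⟩, by rintro ⟨y, rfl⟩; exact y.2⟩

end Cotensor

end PaperQuotient

open PaperQuotient in
/-- For every right `L`-comodule `U`, the map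
`(U □_L O) ⊗_A O → U ⊗_k O`, `(Σᵢ uᵢ ⊗ gᵢ) ⊗ h ↦ Σᵢ uᵢ ⊗ gᵢh` is well defined and
bijective.  (The tensor product over `A` is realized as the quotient of the tensor
product over `k` by the `A`-balancing relations; the `A`-module structure on
`U □_L O` is by right multiplication on the factor `O`, which indeed preserves
`U □_L O`.) -/
theorem statement2
    (k : Type) [Field k] (O : Type) [CommRing O] [HopfAlgebra k O]
    (A : Subalgebra k O) (hA : IsHopfSub k O A)
    (L : Type) [CommRing L] [HopfAlgebra k L]
    (q : O →ₐc[k] L) (hq : IsQuotientHopf k O L A q)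
    (U : Type) [AddCommGroup U] [Module k U]
    (ρU : U →ₗ[k] U ⊗[k] L) (hU : IsComod k L ρU) :
    -- `U □_L O` is stable under right multiplication by elements of `A`
    ∃ H : ∀ (a : ↥A) (x : cotensor k (q : O →ₗ[k] L) ρU),
        (LinearMap.lTensor U (LinearMap.mulRight k (a : O))) (x : U ⊗[k] O) ∈
          cotensor k (q : O →ₗ[k] L) ρU,
      -- the multiplication map `(U □_L O) ⊗_k O → U ⊗_k O` kills exactly the
      -- `A`-balancing relations (well-definedness and injectivity over `A`) ...
      LinearMap.ker
          ((multMap k O U) ∘ₗ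
            LinearMap.rTensor O (cotensor k (q : O →ₗ[k] L) ρU).subtype) =
        Submodule.span k
          {z : ↥(cotensor k (q : O →ₗ[k] L) ρU) ⊗[k] O |
            ∃ (x : cotensor k (q : O →ₗ[k] L) ρU) (a : ↥A) (h : O),
              z = (⟨(LinearMap.lTensor U (LinearMap.mulRight k (a : O))) (x : U ⊗[k] O),
                      H a x⟩ : cotensor k (q : O →ₗ[k] L) ρU) ⊗ₜ[k] h
                  - x ⊗ₜ[k] ((a : O) * h)} ∧
        -- ... and is surjective
        LinearMap.range
          ((multMap k O U) ∘ₗ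
            LinearMap.rTensor O (cotensor k (q : O →ₗ[k] L) ρU).subtype) = ⊤ := by
  have := hA.flat
  exact cotensor_mul_bijective (hq.isBaseQuotient hA) hU
end

section
/- Identifying k ⊗_k O with O, the cotensor product k □_L O of the trivial one-dimensional L-comodule k with O, that is, the set { g ∈ O : Σ q(g₍₁₎) ⊗ g₍₂₎ = q(1) ⊗ g in L ⊗_k O }, is exactly the subalgebra A of O. -/
open TensorProduct

namespace HopfSubalgebra

section Coalgebra

variable {k O : Type*} [Field k] [AddCommGroup O] [Module k O]

/-- The slice map `f ⊗ id : O ⊗ O → O`. -/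
noncomputable def sliceLeft (f : O →ₗ[k] k) : O ⊗[k] O →ₗ[k] O :=
  (TensorProduct.lid k O).toLinearMap ∘ₗ LinearMap.rTensor O f

/-- The slice map `id ⊗ f : O ⊗ O → O`. -/
noncomputable def sliceRight (f : O →ₗ[k] k) : O ⊗[k] O →ₗ[k] O :=
  (TensorProduct.rid k O).toLinearMap ∘ₗ LinearMap.lTensor O f

@[simp]
lemma sliceLeft_tmul (f : O →ₗ[k] k) (x y : O) : sliceLeft f (x ⊗ₜ[k] y) = f x • y := by
  simp [sliceLeft]

@[simp]
lemma sliceRight_tmul (f : O →ₗ[k] k) (x y : O) : sliceRight f (x ⊗ₜ[k] y) = f y • x := by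
  simp [sliceRight]

/-- The subspace `N ⊗ O` of `O ⊗ O`. -/
def tensorTop (N : Submodule k O) : Submodule k (O ⊗[k] O) :=
  Submodule.map₂ (TensorProduct.mk k O O) N ⊤

lemma tmul_mem_tensorTop {N : Submodule k O} {x : O} (hx : x ∈ N) (y : O) :
    x ⊗ₜ[k] y ∈ tensorTop N :=
  Submodule.apply_mem_map₂ _ hx trivial

lemma sliceRight_mem {N : Submodule k O} {z : O ⊗[k] O} (hz : z ∈ tensorTop N)
    (f : O →ₗ[k] k) : sliceRight f z ∈ N := by
  have : tensorTop N ≤ N.comap (sliceRight f) :=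
    Submodule.map₂_le.2 fun x hx y _ => by simpa using N.smul_mem _ hx
  exact this hz

/-- Every tensor is a finite sum of its slices along a basis. -/
lemma exists_sum_sliceRight {ι : Type*} (b : Module.Basis ι k O) (z : O ⊗[k] O) :
    ∃ s : Finset ι, ∑ i ∈ s, sliceRight (b.coord i) z ⊗ₜ[k] b i = z := by
  classical
  refine ⟨(TensorProduct.equivFinsuppOfBasisRight b z).support, ?_⟩
  conv_rhs => rw [← (TensorProduct.equivFinsuppOfBasisRight b).symm_apply_apply z]
  rw [TensorProduct.equivFinsuppOfBasisRight_symm_apply, Finsupp.sum]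
  simp only [TensorProduct.equivFinsuppOfBasisRight_apply]
  rfl

lemma mem_tensorTop_of_sliceRight_mem {N : Submodule k O} {z : O ⊗[k] O}
    (h : ∀ f : O →ₗ[k] k, sliceRight f z ∈ N) : z ∈ tensorTop N := by
  obtain ⟨s, hs⟩ := exists_sum_sliceRight (Module.Basis.ofVectorSpace k O) z
  rw [← hs]
  exact Submodule.sum_mem _ fun i _ => tmul_mem_tensorTop (h _) _

variable [Coalgebra k O]

open Coalgebra

lemma sliceRight_comul_sliceLeft_comul (f g : O →ₗ[k] k) (x : O) :
    sliceRight g (comul (R := k) (sliceLeft f (comul (R := k) x))) =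
      sliceLeft f (comul (R := k) (sliceRight g (comul (R := k) x))) := by
  have h1 : ∀ z : O ⊗[k] O, sliceRight g (comul (R := k) (sliceLeft f z)) =
      sliceLeft f (LinearMap.lTensor O (sliceRight g) (LinearMap.lTensor O comul z)) := by
    intro z
    induction z with
    | zero => simp
    | tmul x y => simp
    | add x y hx hy => simp [hx, hy]
  have h2 : ∀ z : O ⊗[k] O, sliceLeft f (comul (R := k) (sliceRight g z)) =
      sliceLeft f (LinearMap.lTensor O (sliceRight g)
        (TensorProduct.assoc k O O O (LinearMap.rTensor O comul z))) := by
    intro z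
    have h3 : ∀ (w : O ⊗[k] O) (y : O), sliceLeft f (LinearMap.lTensor O (sliceRight g)
        (TensorProduct.assoc k O O O (w ⊗ₜ[k] y))) = g y • sliceLeft f w := by
      intro w y
      induction w with
      | zero => simp
      | tmul u v => simp
      | add u v hu hv => simp [TensorProduct.add_tmul, hu, hv]
    induction z with
    | zero => simp
    | tmul x y => simp [h3]
    | add x y hx hy => simp [hx, hy]
  rw [h1, h2, Coalgebra.coassoc_apply]

/-- A subspace `N` with `Δ(N) ⊆ N ⊗ O`. -/
def IsRightCoideal (N : Submodule k O) : Prop :=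
  ∀ x ∈ N, comul (R := k) x ∈ tensorTop N

/-- Every element lies in a finite-dimensional right coideal. -/
lemma exists_finset_isRightCoideal (x : O) :
    ∃ s : Finset O, x ∈ Submodule.span k (s : Set O) ∧
      IsRightCoideal (Submodule.span k (s : Set O)) := by
  classical
  let b := Module.Basis.ofVectorSpace k O
  obtain ⟨s, hs⟩ := exists_sum_sliceRight b (comul (R := k) x)
  let c := fun i => sliceRight (b.coord i) (comul (R := k) x)
  have hc : ∀ i ∈ s, c i ∈ Submodule.span k ((s.image c : Finset O) : Set O) := fun i hi =>
    Submodule.subset_span (Finset.mem_coe.2 (Finset.mem_image_of_mem _ hi))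
  have hx : comul (R := k) x ∈ tensorTop (Submodule.span k ((s.image c : Finset O) : Set O)) := by
    rw [← hs]
    exact Submodule.sum_mem _ fun i hi => tmul_mem_tensorTop (hc i hi) _
  refine ⟨s.image c, ?_, ?_⟩
  · have h := sliceRight_mem hx counit
    rwa [sliceRight, LinearMap.comp_apply, Coalgebra.lTensor_counit_comul,
      LinearEquiv.coe_coe, TensorProduct.rid_tmul, one_smul] at h
  · intro y hy
    refine Submodule.span_le (p := (tensorTop (Submodule.span k
      ((s.image c : Finset O) : Set O))).comap comul) |>.2 ?_ hy
    intro z hz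
    obtain ⟨i, hi, rfl⟩ := Finset.mem_image.1 (Finset.mem_coe.1 hz)
    refine mem_tensorTop_of_sliceRight_mem fun f => ?_
    have h4 : sliceRight f (comul (R := k) (c i)) = sliceRight (LinearMap.mul' k k ∘ₗ
        TensorProduct.map f (b.coord i) ∘ₗ comul) (comul (R := k) x) := by
      have h5 : ∀ z : O ⊗[k] O, sliceRight f (comul (R := k) (sliceRight (b.coord i) z)) =
          TensorProduct.rid k O (LinearMap.lTensor O (LinearMap.mul' k k ∘ₗ
            TensorProduct.map f (b.coord i))
            (TensorProduct.assoc k O O O (LinearMap.rTensor O comul z))) := by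
        intro z
        have h3 : ∀ (w : O ⊗[k] O) (y : O), TensorProduct.rid k O (LinearMap.lTensor O
            (LinearMap.mul' k k ∘ₗ TensorProduct.map f (b.coord i))
            (TensorProduct.assoc k O O O (w ⊗ₜ[k] y))) = b.coord i y • sliceRight f w := by
          intro w y
          induction w with
          | zero => simp
          | tmul u v => simp [smul_smul, mul_comm]
          | add u v hu hv =>
            simp only [TensorProduct.add_tmul, map_add, hu, hv, smul_add]
        induction z with
        | zero => simp
        | tmul x y =>
          rw [LinearMap.rTensor_tmul, h3, sliceRight_tmul, map_smul, map_smul]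
        | add x y hx hy => simp only [map_add, hx, hy]
      rw [h5, Coalgebra.coassoc_apply, ← LinearMap.comp_apply (LinearMap.lTensor O _),
        ← LinearMap.lTensor_comp]
      rfl
    rw [h4]
    exact sliceRight_mem hx _

end Coalgebra

section Bialgebra

variable {k O : Type*} [Field k] [CommRing O] [Bialgebra k O]

open Coalgebra

/-- `f` is linear over `A`, with `A` acting on `k` through the counit. -/
lemma sliceLeft_mul {A N : Submodule k O} {f : O →ₗ[k] k}
    (hf : ∀ a ∈ A, ∀ n ∈ N, f (a * n) = counit (R := k) a * f n)
    {d z : O ⊗[k] O} (hd : d ∈ tensorTop A) (hz : z ∈ tensorTop N) :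
    sliceLeft f (d * z) = sliceLeft counit d * sliceLeft f z := by
  have key : ∀ a ∈ A, ∀ c : O, ∀ n ∈ N, ∀ x : O,
      sliceLeft f ((a ⊗ₜ[k] c) * (n ⊗ₜ[k] x)) =
        sliceLeft counit (a ⊗ₜ[k] c) * sliceLeft f (n ⊗ₜ[k] x) := by
    intro a ha c n hn x
    simp [hf a ha n hn, smul_smul, mul_comm]
  have h1 : ∀ a ∈ A, ∀ c : O, sliceLeft f ((a ⊗ₜ[k] c) * z) =
      sliceLeft counit (a ⊗ₜ[k] c) * sliceLeft f z := by
    intro a ha c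
    refine Submodule.map₂_le (r := LinearMap.eqLocus
      (sliceLeft f ∘ₗ LinearMap.mulLeft k (a ⊗ₜ[k] c))
      (LinearMap.mulLeft k (sliceLeft counit (a ⊗ₜ[k] c)) ∘ₗ sliceLeft f)) |>.2 ?_ hz
    exact fun n hn x _ => key a ha c n hn x
  refine Submodule.map₂_le (r := LinearMap.eqLocus
      (sliceLeft f ∘ₗ LinearMap.mulRight k z)
      (LinearMap.mulRight k (sliceLeft f z) ∘ₗ sliceLeft counit)) |>.2 ?_ hd
  exact fun a ha c _ => h1 a ha c

lemma sliceLeft_counit_comul (x : O) : sliceLeft counit (comul (R := k) x) = x := by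
  rw [sliceLeft, LinearMap.comp_apply, Coalgebra.rTensor_counit_comul]
  simp

lemma mul_mem_tensorTop {A N N' : Submodule k O} (h : ∀ a ∈ A, ∀ n ∈ N, a * n ∈ N')
    {d z : O ⊗[k] O} (hd : d ∈ tensorTop A) (hz : z ∈ tensorTop N) :
    d * z ∈ tensorTop N' := by
  have h1 : ∀ a ∈ A, ∀ c : O, (a ⊗ₜ[k] c) * z ∈ tensorTop N' := by
    intro a ha c
    refine Submodule.map₂_le (r := (tensorTop N').comap
      (LinearMap.mulLeft k (a ⊗ₜ[k] c))) |>.2 ?_ hz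
    exact fun n hn x _ => by simpa using tmul_mem_tensorTop (h a ha n hn) (c * x)
  refine Submodule.map₂_le (r := (tensorTop N').comap (LinearMap.mulRight k z)) |>.2 ?_ hd
  exact fun a ha c _ => h1 a ha c

/-- The augmentation ideal of a subalgebra. -/
def augIdeal (A : Subalgebra k O) : Ideal A :=
  RingHom.ker ((Bialgebra.counitAlgHom k O).comp A.val)

lemma mem_augIdeal {A : Subalgebra k O} {a : A} :
    a ∈ augIdeal A ↔ counit (R := k) (a : O) = 0 := Iff.rfl

variable {A : Subalgebra k O}

lemma sub_counit_mem_augIdeal (a : A) :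
    a - algebraMap k A (counit (R := k) (a : O)) ∈ augIdeal A := by
  simp [mem_augIdeal]

/-- Every finite subset of `O` lies in a finitely generated `A`-submodule which is a right
coideal. -/
lemma exists_fg_isRightCoideal (hA : IsRightCoideal (Subalgebra.toSubmodule A)) (F : Finset O) :
    ∃ N : Submodule A O, N.FG ∧ (F : Set O) ⊆ N ∧ IsRightCoideal (N.restrictScalars k) := by
  classical
  choose s hs hs' using exists_finset_isRightCoideal (k := k) (O := O)
  refine ⟨Submodule.span A (F.biUnion s : Finset O), ⟨_, rfl⟩, ?_, ?_⟩
  · intro x hx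
    have h : (Submodule.span k (s x : Set O)) ≤
        (Submodule.span A ((F.biUnion s : Finset O) : Set O)).restrictScalars k := by
      refine Submodule.span_le.2 fun y hy => Submodule.subset_span ?_
      exact Finset.mem_coe.2 (Finset.mem_biUnion.2 ⟨x, hx, hy⟩)
    exact h (hs x)
  · intro y hy
    refine Submodule.span_induction ?_ ?_ ?_ ?_ (show y ∈ Submodule.span A _ from hy)
    · intro y hy
      obtain ⟨x, hx, hy⟩ := Finset.mem_biUnion.1 (Finset.mem_coe.1 hy)
      have h : (Submodule.span k (s x : Set O)) ≤
          (Submodule.span A ((F.biUnion s : Finset O) : Set O)).restrictScalars k := by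
        refine Submodule.span_le.2 fun y hy => Submodule.subset_span ?_
        exact Finset.mem_coe.2 (Finset.mem_biUnion.2 ⟨x, hx, hy⟩)
      exact Submodule.map₂_le_map₂_left h (hs' x y (Submodule.subset_span hy))
    · simp
    · intro x y _ _ hx hy
      rw [map_add]
      exact add_mem hx hy
    · intro a x _ hx
      rw [Algebra.smul_def, Bialgebra.comul_mul]
      refine mul_mem_tensorTop (fun b hb n hn => ?_) (hA _ a.2) hx
      exact Submodule.smul_mem (Submodule.span A _) (⟨b, hb⟩ : A) hn

/-- Coordinates on the residue space of `N` modulo `U ⊇ A⁺N`. -/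
lemma exists_residue_coordinates {N U : Submodule A O} (hN : N.FG)
    (hU : augIdeal A • N ≤ U) :
    ∃ (r : ℕ) (n : Fin r → O) (f : Fin r → O →ₗ[k] k), (∀ i, n i ∈ N) ∧
      (∀ i, ∀ u ∈ U, f i u = 0) ∧ (∀ i j, f i (n j) = if i = j then 1 else 0) ∧
      ∀ x ∈ N, x - ∑ i, f i x • n i ∈ U := by
  classical
  obtain ⟨T, hT⟩ := hN
  let U' := U.restrictScalars k
  let W := (N.restrictScalars k).map U'.mkQ
  have hW : W = Submodule.span k (U'.mkQ '' T) := by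
    apply le_antisymm
    · rintro _ ⟨x, hx, rfl⟩
      have hx' : x ∈ Submodule.span A (T : Set O) := hT ▸ hx
      refine Submodule.span_induction ?_ ?_ ?_ ?_ hx'
      · exact fun x hx => Submodule.subset_span ⟨x, hx, rfl⟩
      · simp
      · intro x y _ _ hx hy
        rw [map_add]
        exact add_mem hx hy
      · intro a x hxN hx
        have h : U'.mkQ (a • x) = counit (R := k) (a : O) • U'.mkQ x := by
          rw [← map_smul, ← sub_eq_zero, ← map_sub, Submodule.mkQ_apply,
            Submodule.Quotient.mk_eq_zero]
          have := Submodule.smul_mem_smul (sub_counit_mem_augIdeal a)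
            (show x ∈ N from hT ▸ hxN)
          rw [sub_smul, algebraMap_smul] at this
          exact hU this
        rw [h]
        exact Submodule.smul_mem _ _ hx
    · rw [Submodule.span_le]
      rintro _ ⟨x, hx, rfl⟩
      exact ⟨x, hT ▸ Submodule.subset_span (R := A) hx, rfl⟩
  have : Module.Finite k W :=
    Module.Finite.iff_fg.2 (hW ▸ Submodule.fg_span (T.finite_toSet.image _))
  let b := Module.finBasis k W
  choose n hn hnb using fun i => (b i).2
  choose g hg using fun i => LinearMap.exists_extend (b.coord i)
  have hgW : ∀ i (w : W), g i (w : O ⧸ U') = b.coord i w := fun i w =>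
    LinearMap.congr_fun (hg i) w
  refine ⟨_, n, fun i => g i ∘ₗ U'.mkQ, hn, ?_, ?_, ?_⟩
  · intro i u hu
    have : U'.mkQ u = 0 := (Submodule.Quotient.mk_eq_zero U').2 hu
    rw [LinearMap.comp_apply, this, map_zero]
  · intro i j
    rw [LinearMap.comp_apply, hnb, hgW]
    simp [Finsupp.single_apply, eq_comm]
  · intro x hx
    let w : W := ⟨U'.mkQ x, x, hx, rfl⟩
    have h : U'.mkQ (x - ∑ i, (g i ∘ₗ U'.mkQ) x • n i) = 0 := by
      rw [map_sub, map_sum, sub_eq_zero]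
      simp only [map_smul, hnb, LinearMap.comp_apply]
      have h2 := congrArg (Subtype.val) (b.sum_repr w)
      rw [← show U'.mkQ x = (w : O ⧸ U') from rfl] at h2
      simp only [Submodule.coe_sum, Submodule.coe_smul] at h2
      rw [← h2]
      refine Finset.sum_congr rfl fun i _ => ?_
      rw [h2]
      exact congrArg (· • _) (hgW i w).symm
    exact (Submodule.Quotient.mk_eq_zero U').1 h

end Bialgebra

/-- A form of Nakayama's lemma. -/
lemma exists_sub_one_mem_and_smul_mem_of_le_sup {R M : Type*} [CommRing R] [AddCommGroup M]
    [Module R M] (I : Ideal R) {N C : Submodule R M} (hN : N.FG) (h : N ≤ I • N ⊔ C) :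
    ∃ s : R, s - 1 ∈ I ∧ ∀ n ∈ N, s • n ∈ C := by
  obtain ⟨s, hs, hs'⟩ := Submodule.exists_sub_one_mem_and_smul_eq_zero_of_fg_of_le_smul I
    (N.map C.mkQ) (hN.map _) (by
      rw [← Submodule.map_smul'']
      refine (Submodule.map_mono h).trans ?_
      rw [Submodule.map_sup, C.mkQ_map_self, sup_bot_eq])
  refine ⟨s, hs, fun n hn => ?_⟩
  rw [← Submodule.Quotient.mk_eq_zero C]
  exact hs' _ ⟨n, hn, rfl⟩

section HopfAlgebra

variable {k O : Type*} [Field k] [CommRing O] [HopfAlgebra k O] {A : Subalgebra k O}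

open Coalgebra

/-- The identity `x ⊗ 1 = ∑ Δ(x₍₁₎) (1 ⊗ ι(x₍₂₎))`. -/
lemma sum_comul_mul_antipode {ι : Type*} (s : Finset ι) (x : O) (y z : ι → O)
    (h : ∑ i ∈ s, y i ⊗ₜ[k] z i = comul (R := k) x) :
    ∑ i ∈ s, comul (R := k) (y i) * (1 ⊗ₜ[k] HopfAlgebra.antipode k (z i)) = x ⊗ₜ[k] 1 := by
  have h1 : ∀ w : O ⊗[k] O, ∀ u : O, w * (1 ⊗ₜ[k] HopfAlgebra.antipode k u) =
      LinearMap.lTensor O (LinearMap.mul' k O ∘ₗ LinearMap.lTensor O (HopfAlgebra.antipode k))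
        (TensorProduct.assoc k O O O (w ⊗ₜ[k] u)) := by
    intro w u
    induction w with
    | zero => simp
    | tmul a b => simp
    | add a b ha hb => simp only [add_mul, TensorProduct.add_tmul, map_add, ha, hb]
  simp only [h1, ← LinearMap.rTensor_tmul]
  rw [← map_sum, ← map_sum, ← map_sum, h, Coalgebra.coassoc_apply,
    ← LinearMap.comp_apply (LinearMap.lTensor O _), ← LinearMap.lTensor_comp,
    LinearMap.comp_assoc, HopfAlgebra.mul_antipode_lTensor_comul, LinearMap.lTensor_comp,
    LinearMap.comp_apply, Coalgebra.lTensor_counit_comul]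
  simp

/-- If some `t ∈ A` with `ε(t) = 1` multiplies all right slices of `Δ(x)` into `A`, then
`x` lies in `A`. -/
lemma mem_of_mul_sliceRight_mem
    (hA : ∀ a ∈ A, comul (R := k) a ∈ Submodule.map₂ (TensorProduct.mk k O O)
      (Subalgebra.toSubmodule A) (Subalgebra.toSubmodule A))
    (hS : ∀ a ∈ A, HopfAlgebra.antipode k a ∈ A) {x t : O} (ht : t ∈ A)
    (ht1 : counit (R := k) t = 1)
    (h : ∀ f : O →ₗ[k] k, t * sliceRight f (comul (R := k) x) ∈ A) : x ∈ A := by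
  obtain ⟨π, hπ⟩ := (Subalgebra.toSubmodule A).subtype.exists_leftInverse_of_injective
    (Submodule.ker_subtype _)
  have hπ' : ∀ a ∈ A, (π a : O) = a := fun a ha =>
    congrArg Subtype.val (LinearMap.congr_fun hπ ⟨a, ha⟩)
  let b := Module.Basis.ofVectorSpace k O
  obtain ⟨s, hs⟩ := exists_sum_sliceRight b (comul (R := k) x)
  have hx := sum_comul_mul_antipode s x _ _ hs
  have hmem : comul (R := k) t * (x ⊗ₜ[k] 1) ∈ tensorTop (Subalgebra.toSubmodule A) := by
    rw [← hx, Finset.mul_sum]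
    refine Submodule.sum_mem _ fun i _ => ?_
    rw [← mul_assoc, ← Bialgebra.comul_mul]
    refine mul_mem_tensorTop (N := Submodule.span k {1}) (A := Subalgebra.toSubmodule A) ?_ ?_
      (tmul_mem_tensorTop (Submodule.mem_span_singleton_self 1) _)
    · intro a ha n hn
      obtain ⟨c, rfl⟩ := Submodule.mem_span_singleton.1 hn
      rw [mul_smul_comm, mul_one]
      exact Submodule.smul_mem _ _ ha
    · exact Submodule.map₂_le_map₂_right le_top (hA _ (h _))
  let μ : O ⊗[k] O →ₗ[k] O := LinearMap.mul' k O ∘ₗ LinearMap.lTensor O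
    (HopfAlgebra.antipode k ∘ₗ (Subalgebra.toSubmodule A).subtype ∘ₗ π)
  have h1 : μ (comul (R := k) t * (x ⊗ₜ[k] 1)) ∈ A := by
    have : tensorTop (Subalgebra.toSubmodule A) ≤ (Subalgebra.toSubmodule A).comap μ :=
      Submodule.map₂_le.2 fun a ha c _ => A.mul_mem ha (hS _ (π c).2)
    exact this hmem
  have h2 : ∀ z ∈ Submodule.map₂ (TensorProduct.mk k O O)
      (Subalgebra.toSubmodule A) (Subalgebra.toSubmodule A), μ (z * (x ⊗ₜ[k] 1)) =
      LinearMap.mul' k O (LinearMap.lTensor O (HopfAlgebra.antipode k) z) * x := by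
    intro z hz
    refine Submodule.map₂_le (r := LinearMap.eqLocus
      (μ ∘ₗ LinearMap.mulRight k (x ⊗ₜ[k] 1))
      (LinearMap.mulRight k x ∘ₗ LinearMap.mul' k O ∘ₗ
        LinearMap.lTensor O (HopfAlgebra.antipode k))) |>.2 ?_ hz
    intro a ha c hc
    simp [μ, hπ' c hc, mul_right_comm]
  rw [h2 _ (hA t ht), HopfAlgebra.mul_antipode_lTensor_comul_apply, ht1, map_one, one_mul] at h1
  exact h1

lemma isRightCoideal_toSubmodule
    (hA : ∀ a ∈ A, comul (R := k) a ∈ Submodule.map₂ (TensorProduct.mk k O O)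
      (Subalgebra.toSubmodule A) (Subalgebra.toSubmodule A)) :
    IsRightCoideal (Subalgebra.toSubmodule A) := fun a ha =>
  Submodule.map₂_le_map₂_right le_top (hA a ha)

lemma mem_span_one_iff {x : O} : x ∈ Submodule.span A {(1 : O)} ↔ x ∈ A := by
  rw [Submodule.mem_span_singleton]
  constructor
  · rintro ⟨a, rfl⟩
    rw [Algebra.smul_def, mul_one]
    exact a.2
  · exact fun hx => ⟨⟨x, hx⟩, by rw [Algebra.smul_def, mul_one]; rfl⟩

/-- The elements of `N` killed by the coordinates of the residue space of `N / A` are in `A`. -/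
lemma mem_of_sliceLeft_comul_eq_zero
    (hA : ∀ a ∈ A, comul (R := k) a ∈ Submodule.map₂ (TensorProduct.mk k O O)
      (Subalgebra.toSubmodule A) (Subalgebra.toSubmodule A))
    (hS : ∀ a ∈ A, HopfAlgebra.antipode k a ∈ A)
    {N : Submodule A O} (hN : N.FG) (hN1 : (1 : O) ∈ N)
    (hNΔ : IsRightCoideal (N.restrictScalars k)) {g : O} (hg : g ∈ N)
    (hgf : ∀ f : O →ₗ[k] k, (∀ u ∈ augIdeal A • N ⊔ Submodule.span A {(1 : O)}, f u = 0) →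
      sliceLeft f (comul (R := k) g) = 0) : g ∈ A := by
  classical
  obtain ⟨r, n, f, hn, hf, hfn, hfN⟩ := exists_residue_coordinates hN
    (le_sup_left : augIdeal A • N ≤ augIdeal A • N ⊔ Submodule.span A {(1 : O)})
  let l : Fin r → O →ₗ[k] O := fun i => sliceLeft (f i) ∘ₗ comul
  have hf1 : ∀ i, f i 1 = 0 := fun i =>
    hf i 1 (le_sup_right (a := augIdeal A • N) (Submodule.mem_span_singleton_self 1))
  have hfa : ∀ i, ∀ a ∈ A, ∀ x ∈ N, f i (a * x) = counit (R := k) a * f i x := by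
    intro i a ha x hx
    have h := hf i _ (le_sup_left (b := Submodule.span A {(1 : O)})
      (Submodule.smul_mem_smul (sub_counit_mem_augIdeal ⟨a, ha⟩) hx))
    rw [sub_smul, algebraMap_smul, map_sub, sub_eq_zero, (f i).map_smul] at h
    exact h
  have hl : ∀ i (a : A), ∀ x ∈ N, l i (a • x) = a * l i x := by
    intro i a x hx
    have h := sliceLeft_mul (A := Subalgebra.toSubmodule A) (N := N.restrictScalars k)
      (hfa i) (isRightCoideal_toSubmodule hA _ a.2) (hNΔ x hx)
    rwa [← Bialgebra.comul_mul, sliceLeft_counit_comul] at h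
  have hlA : ∀ i, ∀ a ∈ A, l i a = 0 := by
    intro i a ha
    have h := hl i ⟨a, ha⟩ 1 hN1
    have h1 : l i 1 = 0 := by
      simp [l, Bialgebra.comul_one, Algebra.TensorProduct.one_def, hf1]
    rwa [h1, mul_zero, Algebra.smul_def, mul_one] at h
  obtain ⟨s, hs, hsN⟩ := exists_sub_one_mem_and_smul_mem_of_le_sup (augIdeal A) hN
    (C := Submodule.span A {(1 : O)} ⊔ Submodule.span A (Set.range n)) (by
      intro x hx
      rw [← sup_assoc, ← sub_add_cancel x (∑ i, f i x • n i)]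
      refine Submodule.add_mem_sup (hfN x hx) (Submodule.sum_mem _ fun i _ => ?_)
      rw [← algebraMap_smul A]
      exact Submodule.smul_mem _ _ (Submodule.subset_span ⟨i, rfl⟩))
  have hc : ∀ x ∈ N, ∃ c : Fin r → A, s • x - ∑ j, c j • n j ∈ A := by
    intro x hx
    obtain ⟨y, hy, z, hz, hyz⟩ := Submodule.mem_sup.1 (hsN x hx)
    obtain ⟨c, rfl⟩ := (Submodule.mem_span_range_iff_exists_fun A).1 hz
    refine ⟨c, ?_⟩
    rw [← hyz, add_sub_cancel_right]
    exact mem_span_one_iff.1 hy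
  choose! c hc using hc
  let P : Matrix (Fin r) (Fin r) O := Matrix.of fun i j => l i (n j)
  have hP : ∀ x ∈ N, ∀ i, ∑ j, l i (n j) * (c x j : O) = s * l i x := by
    intro x hx i
    have h := hlA i _ (hc x hx)
    rw [map_sub, map_sum, hl i s x hx, sub_eq_zero] at h
    rw [h]
    exact Finset.sum_congr rfl fun j _ => by rw [hl i _ _ (hn j), mul_comm]
  let b := Module.Basis.ofVectorSpace k O
  have hsl : ∀ x ∈ N, ∀ φ : O →ₗ[k] k, sliceRight φ (comul (R := k) x) ∈ N :=
    fun x hx φ => sliceRight_mem (hNΔ x hx) φ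
  obtain ⟨Q, hQ⟩ : ∃ Q : Matrix (Fin r) (Fin r) O, P * Q = (s : O) • 1 := by
    choose S hS using fun x => exists_sum_sliceRight b (comul (R := k) x)
    refine ⟨Matrix.of fun j m => ∑ e ∈ S (n m),
      (c (sliceRight (b.coord e) (comul (R := k) (n m))) j : O) *
        HopfAlgebra.antipode k (b e), ?_⟩
    ext i m
    have h := congrArg (sliceLeft (f i)) (sum_comul_mul_antipode _ _ _ _ (hS (n m)))
    have hmul : ∀ (w : O ⊗[k] O) (u : O),
        sliceLeft (f i) (w * (1 ⊗ₜ[k] u)) = sliceLeft (f i) w * u := by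
      intro w u
      induction w with
      | zero => simp
      | tmul p q => simp
      | add p q hp hq => simp only [add_mul, map_add, hp, hq]
    rw [sliceLeft_tmul, hfn, map_sum] at h
    simp only [hmul] at h
    rw [Matrix.mul_apply, Matrix.smul_apply, Matrix.one_apply]
    simp only [P, Matrix.of_apply, Finset.mul_sum]
    rw [Finset.sum_comm]
    simp only [← mul_assoc, ← Finset.sum_mul]
    have h2 : (s : O) • (if i = m then (1 : O) else 0) =
        s * (if i = m then (1 : k) else 0) • (1 : O) := by
      split_ifs <;> simp
    rw [h2, ← h, Finset.mul_sum]
    refine Finset.sum_congr rfl fun e _ => ?_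
    rw [hP _ (hsl _ (hn m) _), mul_assoc]
    rfl
  have hdet : P.det * Q.det = (s : O) ^ r := by
    rw [← Matrix.det_mul, hQ, Matrix.det_smul, Matrix.det_one, mul_one, Fintype.card_fin]
  have hs1 : counit (R := k) (s : O) = 1 := by
    have := mem_augIdeal.1 hs
    simpa [sub_eq_zero] using this
  have hK : ∀ x ∈ N, (∀ i, l i x = 0) → (s : O) ^ (r + 1) * x ∈ A := by
    intro x hx hlx
    have h0 : P.mulVec (fun j => (c x j : O)) = 0 := by
      ext i
      have := hP x hx i
      rw [hlx, mul_zero] at this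
      exact this
    have h1 : ∀ j, (s : O) ^ r * (c x j : O) = 0 := by
      intro j
      have h3 := congrArg (P.adjugate.mulVec) h0
      rw [Matrix.mulVec_mulVec, Matrix.adjugate_mul, Matrix.smul_mulVec, Matrix.one_mulVec,
        Matrix.mulVec_zero] at h3
      have h4 : P.det * (c x j : O) = 0 := congrFun h3 j
      rw [← hdet, mul_right_comm, h4, zero_mul]
    have h5 := A.mul_mem (A.pow_mem s.2 r) (hc x hx)
    rw [mul_sub, Finset.mul_sum, Finset.sum_eq_zero, sub_zero] at h5
    · rw [pow_succ, mul_assoc]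
      exact h5
    · intro j _
      rw [Algebra.smul_def, ← mul_assoc]
      exact (congrArg (· * n j) (h1 j)).trans (zero_mul _)
  refine mem_of_mul_sliceRight_mem hA hS (A.pow_mem s.2 (r + 1)) ?_
    fun φ => hK _ (hsl g hg φ) fun i => ?_
  · rw [Bialgebra.counit_pow, hs1, one_pow]
  · change sliceLeft (f i) _ = 0
    rw [← sliceRight_comul_sliceLeft_comul, hgf _ (hf i), map_zero, map_zero]

lemma exists_finset_mem_smul {x : O}
    (hx : x ∈ Ideal.span {a : O | a ∈ A ∧ counit (R := k) a = 0}) :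
    ∃ F : Finset O, ∀ N : Submodule A O, (F : Set O) ⊆ N → x ∈ augIdeal A • N := by
  classical
  obtain ⟨m, c, a, rfl⟩ := Submodule.mem_span_set'.1 hx
  refine ⟨Finset.univ.image c, fun N hN => Submodule.sum_mem _ fun i _ => ?_⟩
  have h := Submodule.smul_mem_smul (I := augIdeal A) (r := ⟨a i, (a i).2.1⟩)
    (mem_augIdeal.2 (a i).2.2) (hN (Finset.mem_coe.2
      (Finset.mem_image_of_mem c (Finset.mem_univ i))))
  rwa [Algebra.smul_def, mul_comm] at h

/-- For a Hopf subalgebra `A`, the right coinvariants modulo `A⁺O` lie in `A`. -/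
theorem mem_of_sliceRight_sub_mem
    (hA : ∀ a ∈ A, comul (R := k) a ∈ Submodule.map₂ (TensorProduct.mk k O O)
      (Subalgebra.toSubmodule A) (Subalgebra.toSubmodule A))
    (hS : ∀ a ∈ A, HopfAlgebra.antipode k a ∈ A) {g : O}
    (hg : ∀ φ : O →ₗ[k] k, sliceRight φ (comul (R := k) g) - φ g • 1 ∈
      Ideal.span {a : O | a ∈ A ∧ counit (R := k) a = 0}) : g ∈ A := by
  classical
  let b := Module.Basis.ofVectorSpace k O
  obtain ⟨s, hs⟩ := exists_sum_sliceRight b (comul (R := k) g)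
  choose F hF using fun e => exists_finset_mem_smul (hg (b.coord e))
  obtain ⟨N, hN, hFN, hNΔ⟩ := exists_fg_isRightCoideal (isRightCoideal_toSubmodule hA)
    ({1, g} ∪ s.biUnion F)
  refine mem_of_sliceLeft_comul_eq_zero hA hS hN (hFN (by simp)) hNΔ (hFN (by simp))
    fun f hf => ?_
  rw [← hs, map_sum]
  refine Finset.sum_eq_zero fun e he => ?_
  have h1 : f 1 = 0 := hf 1 (le_sup_right (a := augIdeal A • N)
    (Submodule.mem_span_singleton_self 1))
  have h2 := hf _ (le_sup_left (b := Submodule.span A {(1 : O)}) (hF e N fun y hy =>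
    hFN (Finset.mem_coe.2 (Finset.mem_union_right _ (Finset.mem_biUnion.2 ⟨e, he, hy⟩)))))
  rw [map_sub, map_smul, h1, smul_zero, sub_zero] at h2
  rw [sliceLeft_tmul, h2, zero_smul]

end HopfAlgebra

end HopfSubalgebra

open PaperQuotient in
/-- Identifying `k ⊗_k O` with `O`, the cotensor product `k □_L O`,
i.e. `{g ∈ O | Σ q(g₍₁₎) ⊗ g₍₂₎ = q(1) ⊗ g}`, is exactly the subalgebra `A`. -/
theorem statement3
    (k : Type) [Field k] (O : Type) [CommRing O] [HopfAlgebra k O]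
    (A : Subalgebra k O) (hA : IsHopfSub k O A)
    (L : Type) [CommRing L] [HopfAlgebra k L]
    (q : O →ₐc[k] L) (hq : IsQuotientHopf k O L A q) :
    {g : O | (LinearMap.rTensor O (q : O →ₗ[k] L)) (Coalgebra.comul (R := k) g) =
        q 1 ⊗ₜ[k] g} = (A : Set O) := by
  have hΔ : ∀ a ∈ A, Coalgebra.comul (R := k) a ∈ Submodule.map₂ (TensorProduct.mk k O O)
      (Subalgebra.toSubmodule A) (Subalgebra.toSubmodule A) := by
    intro a ha
    refine Submodule.span_le.2 ?_ (hA.comul_mem a ha)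
    rintro _ ⟨b, hb, c, hc, rfl⟩
    exact Submodule.apply_mem_map₂ _ hb hc
  have hker : ∀ x : O, q x = 0 ↔
      x ∈ Ideal.span {a : O | a ∈ A ∧ Coalgebra.counit (R := k) a = 0} := by
    intro x
    change _ ↔ x ∈ Ideal.span (augSet k O A)
    rw [← hq.ker]
    rfl
  ext g
  constructor
  · intro hg
    refine HopfSubalgebra.mem_of_sliceRight_sub_mem hΔ hA.antipode_mem fun φ => ?_
    rw [← hker]
    have hφ : ∀ z : O ⊗[k] O, q (HopfSubalgebra.sliceRight φ z) =
        TensorProduct.rid k L (LinearMap.lTensor L φ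
          (LinearMap.rTensor O (q : O →ₗ[k] L) z)) := by
      intro z
      induction z with
      | zero => simp
      | tmul x y => simp
      | add x y hx hy => simp only [map_add, hx, hy]
    rw [map_sub, hφ, show LinearMap.rTensor O (q : O →ₗ[k] L) (Coalgebra.comul (R := k) g) =
      q 1 ⊗ₜ[k] g from hg]
    simp
  · intro hg
    have hqA : ∀ a ∈ A, q a = Coalgebra.counit (R := k) a • q 1 := by
      intro a ha
      rw [← map_smul, ← sub_eq_zero, ← map_sub, hker]
      refine Ideal.subset_span ⟨A.sub_mem ha (A.smul_mem A.one_mem _), ?_⟩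
      simp
    have h : ∀ z ∈ Submodule.map₂ (TensorProduct.mk k O O)
        (Subalgebra.toSubmodule A) (Subalgebra.toSubmodule A),
        LinearMap.rTensor O (q : O →ₗ[k] L) z =
          q 1 ⊗ₜ[k] HopfSubalgebra.sliceLeft Coalgebra.counit z := by
      intro z hz
      refine Submodule.map₂_le (r := LinearMap.eqLocus (LinearMap.rTensor O (q : O →ₗ[k] L))
        (TensorProduct.mk k L O (q 1) ∘ₗ HopfSubalgebra.sliceLeft Coalgebra.counit)) |>.2 ?_ hz
      intro a ha c _
      have h1 := hqA a ha
      simp only [LinearMap.mem_eqLocus, TensorProduct.mk_apply, LinearMap.rTensor_tmul,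
        LinearMap.comp_apply, HopfSubalgebra.sliceLeft_tmul, TensorProduct.tmul_smul]
      rw [TensorProduct.smul_tmul', ← h1]
      rfl
    change LinearMap.rTensor O (q : O →ₗ[k] L) (Coalgebra.comul (R := k) g) = _
    rw [h _ (hΔ g hg), HopfSubalgebra.sliceLeft_counit_comul]
end
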